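/- arXiv:1107.0400 — 3 statements merged into one kernel-verified Lean document; each statement's English description precedes it below -/
import Mathlib

section
/- Let Γ be a unicyclic signed graph with cycle C such that for every vertex v of C, the vertex v is mismatched in the pendant tree Γ{v} (Type II). Then η(Γ) = η(Γ − C) + η(C). -/
open scoped Classical

noncomputable def sadj {V : Type*} [Fintype V] [DecidableEq V]
    (G : SimpleGraph V) (σ : V → V → ℝ) : Matrix V V ℝ :=
  fun u v => if G.Adj u v then σ u v else 0

noncomputable def nullity {V : Type*} [Fintype V] [DecidableEq V]
    (A : Matrix V V ℝ) : ℕ :=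
  Module.finrank ℝ (LinearMap.ker (Matrix.mulVecLin A))

def walkSign {V : Type*} (G : SimpleGraph V) (σ : V → V → ℝ)
    {u v : V} (w : G.Walk u v) : ℝ :=
  (w.darts.map (fun d => σ d.toProd.1 d.toProd.2)).prod

def BalancedSG {V : Type*} (G : SimpleGraph V) (σ : V → V → ℝ) : Prop :=
  ∀ (u : V) (w : G.Walk u u), w.IsCycle → walkSign G σ w = 1

def IsMatchingF {V : Type*} (G : SimpleGraph V) (M : Finset (Sym2 V)) : Prop :=
  (∀ e ∈ M, e ∈ G.edgeSet) ∧
  ∀ e ∈ M, ∀ f ∈ M, e ≠ f → ∀ v : V, ¬(v ∈ e ∧ v ∈ f)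

noncomputable def matchingNumber {V : Type*} (G : SimpleGraph V) : ℕ :=
  sSup {k | ∃ M : Finset (Sym2 V), IsMatchingF G M ∧ M.card = k}

def MatchedIn {V : Type*} (G : SimpleGraph V) (u : V) : Prop :=
  ∀ M : Finset (Sym2 V), IsMatchingF G M → M.card = matchingNumber G → ∃ e ∈ M, u ∈ e

def MismatchedIn {V : Type*} (G : SimpleGraph V) (u : V) : Prop :=
  ∃ M : Finset (Sym2 V), IsMatchingF G M ∧ M.card = matchingNumber G ∧ ∀ e ∈ M, u ∉ e

lemma aux_tree_dist {V : Type*} {T : SimpleGraph V} (hT : T.IsTree) (r u a b : V)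
    (ha : T.Adj u a) (hb : T.Adj u b) (hd : T.dist r u = T.dist r a + 1) :
    b = a ∨ T.dist r b = T.dist r u + 1 := by
  rcases hT.dist_eq_dist_add_one_of_adj r hb with h | h
  · left
    have key : ∀ c, T.Adj u c → T.dist r u = T.dist r c + 1 →
        ∃ p : T.Walk r u, p.IsPath ∧ p.penultimate = c := by
      intro c hc hcd
      obtain ⟨p, hp⟩ := hT.connected.exists_walk_length_eq_dist r c
      refine ⟨p.concat hc.symm, SimpleGraph.Walk.isPath_of_length_eq_dist _ ?_, by simp⟩
      simp [hp, hcd]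
    obtain ⟨p, hp, hpa⟩ := key a ha hd
    obtain ⟨q, hq, hqb⟩ := key b hb h
    have := (hT.isAcyclic.subsingleton_path r u).elim ⟨p, hp⟩ ⟨q, hq⟩
    have h2 : p = q := congrArg Subtype.val this
    rw [← hpa, ← hqb, h2]
  · exact Or.inr h

lemma aux_del {V : Type*} [Fintype V] (G : SimpleGraph V) (hconn : G.Connected)
    (huni : G.edgeSet.ncard = Fintype.card V) (a b : V) (hab : G.Adj a b)
    (hbr : (G.deleteEdges {s(a, b)}).Reachable a b) : (G.deleteEdges {s(a, b)}).IsTree := by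
  rw [SimpleGraph.isTree_iff_connected_and_card]
  refine ⟨hconn.connected_delete_edge_of_not_isBridge (by
    rw [SimpleGraph.isBridge_iff]; exact not_not.mpr hbr), ?_⟩
  rw [Nat.card_coe_set_eq, SimpleGraph.edgeSet_deleteEdges,
    Set.ncard_sdiff_singleton_add_one (by simpa using hab) (Set.toFinite _), huni,
    Nat.card_eq_fintype_card]

lemma aux_le {W : Type*} [Fintype W] (H : SimpleGraph W) (M : Finset (Sym2 W))
    (hM : IsMatchingF H M) : M.card ≤ matchingNumber H := by
  refine le_csSup ⟨Fintype.card (Sym2 W), ?_⟩ ⟨M, hM, rfl⟩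
  rintro k ⟨N, _, rfl⟩
  exact Finset.card_le_univ N

lemma aux_insert {W : Type*} [DecidableEq W] (H : SimpleGraph W) (M : Finset (Sym2 W))
    (hM : IsMatchingF H M) (u v : W) (huv : H.Adj v u) (hv : ∀ e ∈ M, v ∉ e)
    (hu : ∀ e ∈ M, u ∉ e) :
    IsMatchingF H (insert s(v, u) M) ∧ (insert s(v, u) M).card = M.card + 1 := by
  refine ⟨⟨?_, ?_⟩, ?_⟩
  · intro e he
    rcases Finset.mem_insert.mp he with rfl | he
    · simpa using huv
    · exact hM.1 e he
  · intro e he f hf hef y hy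
    rcases Finset.mem_insert.mp he with rfl | he' <;> rcases Finset.mem_insert.mp hf with rfl | hf'
    · exact hef rfl
    · rcases Sym2.mem_iff.mp hy.1 with rfl | rfl
      · exact hv f hf' hy.2
      · exact hu f hf' hy.2
    · rcases Sym2.mem_iff.mp hy.2 with rfl | rfl
      · exact hv e he' hy.1
      · exact hu e he' hy.1
    · exact hM.2 e he' f hf' hef y hy
  · rw [Finset.card_insert_of_notMem]
    intro h
    exact hv _ h (by simp)

lemma aux_descent {W : Type*} [Fintype W] [DecidableEq W] (H : SimpleGraph W) (τ : W → W → ℝ)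
    (hτ : ∀ a b, H.Adj a b → τ a b ≠ 0) (h : W → ℕ) (r : W)
    (hP : ∀ u a b, H.Adj u a → H.Adj u b → h u = h a + 1 → b = a ∨ h b = h u + 1)
    (hr : ∀ u, H.Adj r u → h u = h r + 1)
    (hmis : MismatchedIn H r) (x : W → ℝ)
    (hx : (sadj H τ).mulVec x = Pi.single r 1) : False := by
  have hrow : ∀ a, ∑ b, sadj H τ a b * x b = if a = r then 1 else 0 := by
    intro a
    have := congrFun hx a
    simpa [Matrix.mulVec, dotProduct, Pi.single_apply] using this
  have key : ∀ k : ℕ, ∃ (M : Finset (Sym2 W)) (v u : W), IsMatchingF H M ∧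
      M.card = matchingNumber H ∧ (∀ e ∈ M, v ∉ e) ∧ H.Adj v u ∧ h u = h v + 1 ∧
      h r ≤ h v ∧ x u ≠ 0 ∧ k ≤ h v := by
    intro k
    induction k with
    | zero =>
      obtain ⟨M, hM, hMc, hMr⟩ := hmis
      have h1 : ∑ b, sadj H τ r b * x b ≠ 0 := by rw [hrow]; simp
      obtain ⟨u, -, hu⟩ := Finset.exists_ne_zero_of_sum_ne_zero h1
      have hadj : H.Adj r u := by
        by_contra hn
        exact hu (by simp [sadj, hn])
      exact ⟨M, r, u, hM, hMc, hMr, hadj, hr u hadj, le_rfl, right_ne_zero_of_mul hu, Nat.zero_le _⟩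
    | succ k ih =>
      obtain ⟨M, v, u, hM, hMc, hMv, hvu, huv, hrv, hxu, hk⟩ := ih
      have hcov : ∃ e ∈ M, u ∈ e := by
        by_contra hn
        push Not at hn
        have h1 := aux_insert H M hM u v hvu hMv hn
        have h2 := aux_le H _ h1.1
        omega
      obtain ⟨e, heM, hue⟩ := hcov
      obtain ⟨u', rfl⟩ := hue
      have hadj : H.Adj u u' := by simpa using hM.1 _ heM
      have hne : u' ≠ v := by
        rintro rfl
        exact hMv _ heM (by simp)
      have hu' : h u' = h u + 1 := (hP u v u' hvu.symm hadj huv).resolve_left hne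
      have hur : u' ≠ r := by
        rintro rfl
        omega
      have h0 := hrow u'
      rw [if_neg hur, ← Finset.add_sum_erase _ _ (Finset.mem_univ u)] at h0
      have hnz : sadj H τ u' u * x u ≠ 0 := by
        refine mul_ne_zero ?_ hxu
        simp only [sadj, if_pos hadj.symm]
        exact hτ _ _ hadj.symm
      have h1 : ∑ b ∈ Finset.univ.erase u, sadj H τ u' b * x b ≠ 0 := by
        intro h2
        rw [h2, add_zero] at h0
        exact hnz h0
      obtain ⟨b, hb, hbz⟩ := Finset.exists_ne_zero_of_sum_ne_zero h1
      have hbu : b ≠ u := Finset.ne_of_mem_erase hb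
      have hadj' : H.Adj u' b := by
        by_contra hn
        exact hbz (by simp [sadj, hn])
      have hhb : h b = h u' + 1 := (hP u' u b hadj.symm hadj' hu').resolve_left hbu
      have hN : IsMatchingF H (M.erase s(u, u')) :=
        ⟨fun e he => hM.1 e (Finset.mem_of_mem_erase he), fun e he f hf =>
          hM.2 e (Finset.mem_of_mem_erase he) f (Finset.mem_of_mem_erase hf)⟩
      have hNu : ∀ y, y ∈ s(u, u') → ∀ e ∈ M.erase s(u, u'), y ∉ e := fun y hy e he hye =>
        hM.2 e (Finset.mem_of_mem_erase he) _ heM (Finset.ne_of_mem_erase he) y ⟨hye, hy⟩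
      have h3 := aux_insert H _ hN u v hvu (fun e he => hMv e (Finset.mem_of_mem_erase he))
        (hNu u (by simp))
      refine ⟨_, u', b, h3.1, ?_, ?_, hadj', hhb, by omega, right_ne_zero_of_mul hbz, by omega⟩
      · rw [h3.2, Finset.card_erase_add_one heM, hMc]
      · intro e he
        rcases Finset.mem_insert.mp he with rfl | he
        · simp [hne, hadj.ne']
        · exact hNu u' (by simp) e he
  obtain ⟨M, v, u, -, -, -, -, -, -, -, hk⟩ := key (Finset.univ.sup h + 1)
  have := Finset.le_sup (f := h) (Finset.mem_univ v)
  omega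

lemma aux_dual {W : Type*} [Fintype W] [DecidableEq W] (A : Matrix W W ℝ)
    (hA : ∀ a b, A a b = A b a) (r : W) (hr : ∀ x, A.mulVec x ≠ Pi.single r 1) :
    ∃ z : W → ℝ, z r = 1 ∧ ∀ a, ∑ b, A a b * z b = 0 := by
  have hn : (Pi.single r 1 : W → ℝ) ∉ LinearMap.range (Matrix.mulVecLin A) := by
    rintro ⟨x, hx⟩
    exact hr x hx
  obtain ⟨f, hf, hker⟩ := Submodule.exists_le_ker_of_notMem hn
  refine ⟨fun b => f (Pi.single b 1) / f (Pi.single r 1), div_self hf, fun a => ?_⟩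
  have h1 : f (A.mulVec (Pi.single a 1)) = 0 := hker ⟨_, rfl⟩
  have h2 : A.mulVec (Pi.single a 1) = ∑ b, A a b • (Pi.single b 1 : W → ℝ) := by
    ext c
    simp [Matrix.mulVec_single, Finset.sum_apply, Pi.single_apply, hA a c]
  rw [h2, map_sum] at h1
  simp only [map_smul, smul_eq_mul] at h1
  simp only [← mul_div_assoc]
  rw [← Finset.sum_div, h1, zero_div]

lemma aux_ker {W : Type*} [Fintype W] [DecidableEq W] (A : Matrix W W ℝ) (z : W → ℝ) :
    z ∈ LinearMap.ker (Matrix.mulVecLin A) ↔ ∀ a, ∑ b, A a b * z b = 0 := by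
  simp [LinearMap.mem_ker, funext_iff, Matrix.mulVec, dotProduct]

lemma aux_lin {V : Type*} [Fintype V] [DecidableEq V] (A : Matrix V V ℝ)
    (hA : ∀ a b, A a b = A b a) (p : V → Prop) [Fintype {a // ¬ p a}] [Fintype {a // p a}]
    [DecidableEq {a // ¬ p a}] [DecidableEq {a // p a}]
    (y : {a // p a} → {a // ¬ p a} → ℝ)
    (h1 : ∀ c (a : {a // ¬ p a}), ∑ b, A a.1 b.1 * y c b = A a.1 c.1)
    (h2 : ∀ c d : {a // p a}, ∑ b : {a // ¬ p a}, A d.1 b.1 * y c b = 0) :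
    nullity A = nullity (A.submatrix (Subtype.val : {a // ¬ p a} → V) Subtype.val) +
      nullity (A.submatrix (Subtype.val : {a // p a} → V) Subtype.val) := by
  have split : ∀ f : V → ℝ, ∑ b, f b = ∑ b : {a // ¬ p a}, f b.1 + ∑ b : {a // p a}, f b.1 := by
    intro f
    rw [add_comm]
    convert (Fintype.sum_subtype_add_sum_subtype p f).symm
  have swap : ∀ (a : V) (z : {a // p a} → ℝ),
      ∑ b : {a // ¬ p a}, A a b.1 * ∑ c, y c b * z c
        = ∑ c, (∑ b : {a // ¬ p a}, A a b.1 * y c b) * z c := by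
    intro a z
    simp only [Finset.mul_sum, Finset.sum_mul]
    rw [Finset.sum_comm]
    simp only [mul_assoc]
  have hB : ∀ g : {a // ¬ p a} → ℝ, (∀ a : {a // ¬ p a}, ∑ b : {a // ¬ p a}, A a.1 b.1 * g b = 0) →
      ∀ d : {a // p a}, ∑ b : {a // ¬ p a}, A d.1 b.1 * g b = 0 := by
    intro g hg d
    have : ∀ b : {a // ¬ p a}, A d.1 b.1 * g b = ∑ a : {a // ¬ p a}, y d a * (A a.1 b.1 * g b) := by
      intro b
      rw [hA d.1 b.1, ← h1 d b, Finset.sum_mul]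
      refine Finset.sum_congr rfl fun a _ => ?_
      rw [hA b.1 a.1]
      ring
    rw [Finset.sum_congr rfl fun b _ => this b, Finset.sum_comm]
    simp only [← Finset.mul_sum, hg, mul_zero, Finset.sum_const_zero]
  unfold nullity
  rw [← Module.finrank_prod]
  refine LinearEquiv.finrank_eq (LinearEquiv.ofLinearMap
    (LinearMap.prod
      (LinearMap.codRestrict _
        ({ toFun := fun z b => z.1 b.1 + ∑ c, y c b * z.1 c.1
           map_add' := ?_
           map_smul' := ?_ } : _ →ₗ[ℝ] ({a // ¬ p a} → ℝ)) ?_)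
      (LinearMap.codRestrict _
        ({ toFun := fun z c => z.1 c.1
           map_add' := ?_
           map_smul' := ?_ } : _ →ₗ[ℝ] ({a // p a} → ℝ)) ?_))
    (LinearMap.codRestrict _
        ({ toFun := fun gz a => if h : p a then gz.2.1 ⟨a, h⟩ else
              gz.1.1 ⟨a, h⟩ - ∑ c, y c ⟨a, h⟩ * gz.2.1 c
           map_add' := ?_
           map_smul' := ?_ } : _ →ₗ[ℝ] (V → ℝ)) ?_) ?_ ?_)
  · intro z z'
    ext b
    simp [mul_add, Finset.sum_add_distrib]
    ring
  · intro t z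
    ext b
    simp [mul_add, Finset.mul_sum]
    exact Finset.sum_congr rfl fun _ _ => by ring
  · rintro ⟨z, hz⟩
    rw [aux_ker] at hz ⊢
    intro a
    simp only [LinearMap.coe_mk, AddHom.coe_mk, Matrix.submatrix_apply, mul_add, Finset.sum_add_distrib]
    rw [swap, ← hz a.1, split]
    simp only [h1]
  · intro z z'
    ext b
    simp
  · intro t z
    ext b
    simp
  · rintro ⟨z, hz⟩
    rw [aux_ker] at hz ⊢
    have hg : ∀ d : V, ∑ b : {a // ¬ p a}, A d b.1 * (z b.1 + ∑ c, y c b * z c.1) =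
        ∑ b : {a // ¬ p a}, A d b.1 * z b.1 +
          ∑ c : {a // p a}, (∑ b : {a // ¬ p a}, A d b.1 * y c b) * z c.1 := by
      intro d
      simp only [mul_add, Finset.sum_add_distrib]
      rw [swap]
    have h3 := hB (fun b => z b.1 + ∑ c, y c b * z c.1) (fun a => by
      rw [hg, ← hz a.1, split]
      simp only [h1])
    intro d
    have h4 := h3 d
    rw [hg] at h4
    simp only [h2, zero_mul, Finset.sum_const_zero, add_zero] at h4
    have h5 := hz d.1
    rw [split, h4, zero_add] at h5
    exact h5
  · intro z z'
    ext a
    by_cases h : p a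
    · simp [h]
    · simp [h, mul_add, Finset.sum_add_distrib]
      ring
  · intro t z
    ext a
    by_cases h : p a
    · simp [h]
    · simp only [h, dite_false, Pi.smul_apply, smul_eq_mul, mul_sub, Finset.mul_sum, Prod.smul_fst,
        Prod.smul_snd, SetLike.val_smul, RingHom.id_apply]
      congr 1
      exact Finset.sum_congr rfl fun _ _ => by ring
  · rintro ⟨⟨g, hg⟩, ⟨z, hz⟩⟩
    rw [aux_ker] at hg hz ⊢
    simp only [Matrix.submatrix_apply] at hg hz
    intro d
    rw [split]
    simp only [LinearMap.coe_mk, AddHom.coe_mk, Subtype.coe_eta]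
    have e1 : ∀ b : {a // p a}, (if h : p b.1 then z ⟨b.1, h⟩ else
        g ⟨b.1, h⟩ - ∑ c, y c ⟨b.1, h⟩ * z c) = z b := fun b => by rw [dif_pos b.2]
    have e2 : ∀ b : {a // ¬ p a}, (if h : p b.1 then z ⟨b.1, h⟩ else
        g ⟨b.1, h⟩ - ∑ c, y c ⟨b.1, h⟩ * z c) = g b - ∑ c, y c b * z c :=
      fun b => by rw [dif_neg b.2]
    simp only [e1, e2, mul_sub, Finset.sum_sub_distrib]
    rw [swap]
    by_cases hd : p d
    · have := hB g hg ⟨d, hd⟩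
      have h3 := hz ⟨d, hd⟩
      have h4 := fun c => h2 c ⟨d, hd⟩
      simp only at this h3 h4
      rw [this, h3]
      simp [h4]
    · have := hg ⟨d, hd⟩
      have h4 := fun c => h1 c ⟨d, hd⟩
      simp only at this h4
      rw [this]
      simp [h4]
  · refine LinearMap.ext ?_
    rintro ⟨⟨g, hg⟩, ⟨z, hz⟩⟩
    refine Prod.ext (Subtype.ext (funext fun b => ?_)) (Subtype.ext (funext fun b => ?_))
    · have hs : ∀ x : {a // p a}, p x.1 := fun x => x.2
      simp [b.2, hs]
    · simp [b.2]
  · refine LinearMap.ext ?_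
    rintro ⟨z, hz⟩
    refine Subtype.ext (funext fun a => ?_)
    by_cases h : p a <;> simp [h]

lemma aux_pendant {V : Type*} [Fintype V] [DecidableEq V]
    (G : SimpleGraph V) (σ : V → V → ℝ)
    (hconn : G.Connected) (huni : G.edgeSet.ncard = Fintype.card V)
    (hsym : ∀ u v, σ u v = σ v u)
    (hpm : ∀ u v, G.Adj u v → σ u v = 1 ∨ σ u v = -1)
    (x : V) (w : G.Walk x x) (hw : w.IsCycle) (v : V) (hv : v ∈ w.support)
    (hmis : MismatchedIn
        ((G.induce {y | y ∉ w.support ∨ y = v}).induce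
          (((G.induce {y | y ∉ w.support ∨ y = v}).connectedComponentMk
            ⟨v, Or.inr rfl⟩).supp))
        ⟨⟨v, Or.inr rfl⟩, rfl⟩) :
    ∃ y : {a // ¬ a ∈ w.support} → ℝ,
      (∀ a : {a // ¬ a ∈ w.support}, ∑ b, sadj G σ a.1 b.1 * y b = sadj G σ a.1 v) ∧
      ∀ d : {a // a ∈ w.support}, ∑ b : {a // ¬ a ∈ w.support}, sadj G σ d.1 b.1 * y b = 0 := by
  -- the tree obtained by removing a cycle edge
  obtain ⟨e, he⟩ : ∃ e, e ∈ w.edges := by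
    refine List.exists_mem_of_ne_nil _ ?_
    intro h
    have h3 := hw.three_le_length
    rw [← SimpleGraph.Walk.length_edges, h] at h3
    simp at h3
  induction e with | h p q
  have hpq : G.Adj p q := by simpa using w.edges_subset_edgeSet he
  have hps : p ∈ w.support := w.fst_mem_support_of_mem_edges he
  have hqs : q ∈ w.support := w.snd_mem_support_of_mem_edges he
  have hT := aux_del G hconn huni p q hpq
    (SimpleGraph.adj_and_reachable_delete_edges_iff_exists_cycle.mpr ⟨x, w, hw, he⟩).2
  set T := G.deleteEdges {s(p, q)} with hTdef
  set S : Set V := {y | y ∉ w.support ∨ y = v} with hS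
  set K := ((G.induce S).connectedComponentMk ⟨v, Or.inr rfl⟩).supp with hK
  set r : K := ⟨⟨v, Or.inr rfl⟩, rfl⟩ with hr
  have hHT : ∀ a b : K, ((G.induce S).induce K).Adj a b → T.Adj a.1.1 b.1.1 := by
    intro a b hab
    have hab' : G.Adj a.1.1 b.1.1 := hab
    rw [hTdef, SimpleGraph.deleteEdges_adj]
    refine ⟨hab', fun h => ?_⟩
    have ha := a.1.2
    have hb := b.1.2
    simp only [hS, Set.mem_ofPred_eq] at ha hb
    have hne := hab'.ne
    rcases Sym2.eq_iff.mp (Set.mem_singleton_iff.mp h) with ⟨h1, h2⟩ | ⟨h1, h2⟩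
    · rw [h1, h2] at hne
      rw [h1] at ha
      rw [h2] at hb
      exact hne ((ha.resolve_left (not_not.mpr hps)).trans (hb.resolve_left (not_not.mpr hqs)).symm)
    · rw [h1, h2] at hne
      rw [h1] at ha
      rw [h2] at hb
      exact hne ((ha.resolve_left (not_not.mpr hqs)).trans (hb.resolve_left (not_not.mpr hps)).symm)
  obtain ⟨z, hzr, hz⟩ := aux_dual
    (sadj ((G.induce S).induce K) (fun a b => σ a.1.1 b.1.1))
    (by
      intro a b
      simp only [sadj, SimpleGraph.adj_comm _ a b, hsym a.1.1 b.1.1]) r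
    (fun x' hx' => aux_descent _ _ (by
      intro a b hab
      rcases hpm a.1.1 b.1.1 hab with h | h <;> rw [h] <;> norm_num)
      (fun a => T.dist v a.1.1) r
      (by
        intro u a b hua hub hd
        rcases aux_tree_dist hT v u.1.1 a.1.1 b.1.1 (hHT _ _ hua) (hHT _ _ hub) hd with h | h
        · exact Or.inl (Subtype.ext (Subtype.ext h))
        · exact Or.inr h)
      (by
        intro u hu
        have h1 : T.dist v u.1.1 = 1 := SimpleGraph.dist_eq_one_iff_adj.mpr (hHT _ _ hu)
        simp [h1, hr]) hmis x' hx')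
  set ι : K → V := fun a => a.1.1 with hι
  have hinj : Function.Injective ι := fun a b h => Subtype.ext (Subtype.ext h)
  set z' : V → ℝ := Function.extend ι z 0 with hz'
  have hz'ι : ∀ a, z' (ι a) = z a := fun a => hinj.extend_apply _ _ _
  have hz'0 : ∀ a, a ∉ Set.range ι → z' a = 0 := fun a ha => by
    rw [hz', Function.extend_apply' _ _ _ (by simpa using ha)]; rfl
  have hz'v : z' v = 1 := by rw [← hzr, ← hz'ι]
  have hz's : ∀ a ∈ w.support, a ≠ v → z' a = 0 := by
    intro a ha hav
    refine hz'0 a ?_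
    rintro ⟨k, rfl⟩
    rcases k.1.2 with h | h
    · exact h ha
    · exact hav h
  have hsum : ∀ f : V → ℝ, ∑ b : {a // ¬ a ∈ w.support}, f b.1 * (- z' b.1)
      = f v - ∑ b : K, f (ι b) * z b := by
    intro f
    have e1 : ∑ b : K, f (ι b) * z b = ∑ b, f b * z' b :=
      Fintype.sum_of_injective ι hinj _ _ (fun i hi => by rw [hz'0 i hi, mul_zero])
        (fun i => by rw [hz'ι])
    have e2 : ∑ b : {a // a ∈ w.support}, f b.1 * z' b.1 = f v := by
      rw [Finset.sum_eq_single (⟨v, hv⟩ : {a // a ∈ w.support})]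
      · rw [hz'v, mul_one]
      · intro b _ hb
        rw [hz's b.1 b.2 (fun h => hb (Subtype.ext h)), mul_zero]
      · simp
    have e3 := Fintype.sum_subtype_add_sum_subtype (fun a => a ∈ w.support) (fun b => f b * z' b)
    rw [e1, ← e3]
    simp only [mul_neg, Finset.sum_neg_distrib]
    have this : ∀ A B D : ℝ, D = f v → A = B → -A = f v - (D + B) := by
      intro A B D h h'
      rw [h, h']
      ring
    apply this
    · convert e2
    · congr!
  have hrow : ∀ a ∈ S, ∑ b : K, sadj G σ a (ι b) * z b = 0 := by
    intro a ha
    by_cases hk : (⟨a, ha⟩ : S) ∈ K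
    · exact hz ⟨⟨a, ha⟩, hk⟩
    · refine Finset.sum_eq_zero fun b _ => ?_
      have : ¬ G.Adj a (ι b) := by
        intro hab
        apply hk
        have h1 : (G.induce S).Adj ⟨a, ha⟩ b.1 := hab
        exact SimpleGraph.ConnectedComponent.mem_supp_of_adj_mem_supp _ b.2 h1.symm
      simp [sadj, this]
  refine ⟨fun b => - z' b.1, fun a => ?_, fun d => ?_⟩
  · rw [hsum (fun b => sadj G σ a.1 b), hrow a.1 (Or.inl a.2), sub_zero]
  · by_cases hdv : d.1 = v
    · rw [hsum (fun b => sadj G σ d.1 b), hdv, hrow v (Or.inr rfl)]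
      simp [sadj]
    · refine Finset.sum_eq_zero fun b _ => ?_
      by_cases hb : b.1 ∈ Set.range ι
      · have : ¬ G.Adj d.1 b.1 := by
          intro hdb
          obtain ⟨k, hk⟩ := hb
          have hwe : ∀ e ∈ w.edges, e ∈ (G.deleteEdges {s(d.1, b.1)}).edgeSet := by
            intro e he
            rw [SimpleGraph.edgeSet_deleteEdges]
            refine ⟨w.edges_subset_edgeSet he, fun h => ?_⟩
            rw [Set.mem_singleton_iff.mp h] at he
            exact b.2 (w.snd_mem_support_of_mem_edges he)
          have hcyc := hw.transfer hwe
          have hreach : ∀ a ∈ w.support, (G.deleteEdges {s(d.1, b.1)}).Reachable x a := by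
            intro a ha
            exact ⟨(w.transfer _ hwe).takeUntil a (by simpa using ha)⟩
          let φ : (G.induce S) →g (G.deleteEdges {s(d.1, b.1)}) :=
            { toFun := Subtype.val
              map_rel' := by
                intro a c hac
                have hac' : G.Adj a.1 c.1 := hac
                rw [SimpleGraph.deleteEdges_adj]
                refine ⟨hac', fun h => ?_⟩
                have hd : d.1 ∉ S := by
                  rintro (h | h)
                  · exact h d.2
                  · exact hdv h
                rcases Sym2.eq_iff.mp (Set.mem_singleton_iff.mp h) with ⟨h1, h2⟩ | ⟨h1, h2⟩
                · exact hd (h1 ▸ a.2)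
                · exact hd (h2 ▸ c.2) }
          have h1 : (G.induce S).Reachable k.1 ⟨v, Or.inr rfl⟩ :=
            SimpleGraph.ConnectedComponent.exact k.2
          have h2 : (G.deleteEdges {s(d.1, b.1)}).Reachable (ι k) v := h1.map φ
          rw [hk] at h2
          have h3 := aux_del G hconn huni d.1 b.1 hdb
            ((hreach d.1 d.2).symm.trans ((hreach v hv).trans h2.symm))
          exact h3.isAcyclic _ hcyc
        simp [sadj, this]
      · simp [hz'0 _ hb]

lemma aux_inst {W : Type*} (i1 i2 : Fintype W) (d1 d2 : DecidableEq W) (A : Matrix W W ℝ) :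
    @nullity W i1 d1 A = @nullity W i2 d2 A := by
  cases Subsingleton.elim i1 i2
  cases Subsingleton.elim d1 d2
  rfl

/-- if Γ is a unicyclic signed graph of Type II (every vertex v of the
cycle C is mismatched in its pendant tree Γ{v}), then η(Γ) = η(Γ − C) + η(C). -/
theorem stmt16 {V : Type*} [Fintype V] [DecidableEq V]
    (G : SimpleGraph V) (σ : V → V → ℝ)
    (hconn : G.Connected) (huni : G.edgeSet.ncard = Fintype.card V)
    (hsym : ∀ u v, σ u v = σ v u)
    (hpm : ∀ u v, G.Adj u v → σ u v = 1 ∨ σ u v = -1)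
    (x : V) (w : G.Walk x x) (hw : w.IsCycle)
    (htype2 : ∀ v, ∀ hv : v ∈ w.support,
      MismatchedIn
        ((G.induce {y | y ∉ w.support ∨ y = v}).induce
          (((G.induce {y | y ∉ w.support ∨ y = v}).connectedComponentMk
            ⟨v, Or.inr rfl⟩).supp))
        ⟨⟨v, Or.inr rfl⟩, rfl⟩) :
    nullity (sadj G σ) =
      nullity (sadj (G.induce {y | y ∉ w.support}) (fun a b => σ a.1 b.1)) +
      nullity (sadj (G.induce {y | y ∈ w.support}) (fun a b => σ a.1 b.1)) := by
  choose y h1 h2 using fun c : {a // a ∈ w.support} =>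
    aux_pendant G σ hconn huni hsym hpm x w hw c.1 c.2 (htype2 c.1 c.2)
  refine (aux_lin (sadj G σ)
    (fun a b => by simp only [sadj, SimpleGraph.adj_comm _ a b, hsym a b])
    (fun a => a ∈ w.support) y h1 h2).trans (congrArg₂ (· + ·) ?_ ?_)
  · exact aux_inst _ _ _ _ _
  · exact aux_inst _ _ _ _ _
end

section
/- A unicyclic signed graph Γ on n vertices satisfies η(Γ) = n − 3 if and only if n = 3 and Γ is a (signed) triangle C₃. -/
open scoped Classical

lemma aux_minor {V : Type*} [Fintype V] (A : Matrix V V ℝ) (hA : A.transpose = A)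
    (hr : A.rank = 3) : ∃ f : Fin 3 → V, (A.submatrix f f).det ≠ 0 := by
  have key := Submodule.exists_fun_fin_finrank_span_eq ℝ (Set.range A.row)
  rw [← Matrix.rank_eq_finrank_span_row, hr] at key
  obtain ⟨g, hg, hspan, -⟩ := key
  choose f hf using hg
  refine ⟨f, fun hdet => ?_⟩
  have hB : ∀ i, ∃ c : Fin 3 → ℝ, ∑ j, c j • g j = A.row i := fun i => by
    rw [← Submodule.mem_span_range_iff_exists_fun, hspan]
    exact Submodule.subset_span ⟨i, rfl⟩
  choose B hB using hB
  have hf' : ∀ j, A (f j) = g j := hf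
  have e1 : A = Matrix.of B * A.submatrix f id := by
    ext i k
    have := congrFun (hB i) k
    simp only [Finset.sum_apply, Pi.smul_apply, smul_eq_mul, ← hf'] at this
    simp only [Matrix.mul_apply, Matrix.submatrix_apply, Matrix.of_apply, id]
    exact this.symm
  have e2 : A.submatrix id f = Matrix.of B * A.submatrix f f := by
    ext i k
    exact congrFun (congrFun e1 i) (f k)
  have e3 : (A.submatrix id f).transpose = A.submatrix f id := by
    rw [Matrix.transpose_submatrix, hA]
  have r1 : 3 ≤ (A.submatrix f id).rank := by
    have := Matrix.rank_mul_le_right (Matrix.of B) (A.submatrix f id)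
    rw [← e1] at this
    omega
  rw [← e3, Matrix.rank_transpose, e2] at r1
  have r2 := r1.trans (Matrix.rank_mul_le_right _ _)
  obtain ⟨v, hv, hv0⟩ := Matrix.exists_mulVec_eq_zero_iff.2 hdet
  have r3 := LinearMap.finrank_range_add_finrank_ker (Matrix.mulVecLin (A.submatrix f f))
  have r4 : 3 ≤ Module.finrank ℝ (LinearMap.range (Matrix.mulVecLin (A.submatrix f f))) := r2
  rw [Module.finrank_fintype_fun_eq_card, Fintype.card_fin] at r3
  have r5 : Module.finrank ℝ (LinearMap.ker (Matrix.mulVecLin (A.submatrix f f))) = 0 := by omega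
  rw [Submodule.finrank_eq_zero] at r5
  have : v ∈ LinearMap.ker (Matrix.mulVecLin (A.submatrix f f)) := by simpa using hv0
  rw [r5] at this
  exact hv (by simpa using this)

lemma aux_edges {V : Type*} [Fintype V] (G : SimpleGraph V)
    (hconn : G.Connected) (huni : G.edgeSet.ncard = Fintype.card V)
    {a b c d : V} (hab : G.Adj a b) (hbc : G.Adj b c) (hac : G.Adj a c)
    (hda : G.Adj d a) (hdb : G.Adj d b) (hdc : d ≠ c) : False := by
  have h1 : ¬ G.IsBridge s(a, b) := by
    rw [SimpleGraph.isBridge_iff, not_not]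
    have e1 : (G.deleteEdges {s(a, b)}).Adj a c := by
      simp [SimpleGraph.deleteEdges_adj, hac, hac.ne, hbc.ne', hab.ne]
    have e2 : (G.deleteEdges {s(a, b)}).Adj c b := by
      simp [SimpleGraph.deleteEdges_adj, hbc.symm, hac.ne', hbc.ne', hab.ne]
    exact e1.reachable.trans e2.reachable
  have c1 := hconn.connected_delete_edge_of_not_isBridge h1
  have h2 : ¬ (G.deleteEdges {s(a, b)}).IsBridge s(a, d) := by
    rw [SimpleGraph.isBridge_iff, not_not]
    have e1 : ((G.deleteEdges {s(a, b)}).deleteEdges {s(a, d)}).Adj a c := by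
      simp [SimpleGraph.deleteEdges_adj, hac, hac.ne, hbc.ne', hab.ne, hdc.symm, hac.ne']
    have e2 : ((G.deleteEdges {s(a, b)}).deleteEdges {s(a, d)}).Adj c b := by
      simp [SimpleGraph.deleteEdges_adj, hbc.symm, hac.ne', hbc.ne', hab.ne, hdc.symm]
    have e3 : ((G.deleteEdges {s(a, b)}).deleteEdges {s(a, d)}).Adj b d := by
      simp [SimpleGraph.deleteEdges_adj, hdb.symm, hab.ne', hda.ne, hdb.ne']
    exact (e1.reachable.trans e2.reachable).trans e3.reachable
  have c2 := (c1.connected_delete_edge_of_not_isBridge h2).card_vert_le_card_edgeSet_add_one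
  rw [SimpleGraph.edgeSet_deleteEdges, SimpleGraph.edgeSet_deleteEdges, Nat.card_coe_set_eq,
    Nat.card_eq_fintype_card] at c2
  have k1 : (G.edgeSet \ {s(a, b)}).ncard + 1 = G.edgeSet.ncard :=
    Set.ncard_sdiff_singleton_add_one (by simpa using hab) (Set.toFinite _)
  have k2 : ((G.edgeSet \ {s(a, b)}) \ {s(a, d)}).ncard + 1 = (G.edgeSet \ {s(a, b)}).ncard :=
    Set.ncard_sdiff_singleton_add_one (by simp [hda.symm, hdb.ne, hda.ne, hab.ne]) (Set.toFinite _)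
  omega

lemma aux_rank {V : Type*} [Fintype V] (A : Matrix V V ℝ) (k : ℕ) (f : Fin k → V)
    (h : (A.submatrix f f).det ≠ 0) : k ≤ A.rank := by
  have h1 := Matrix.rank_of_det_ne_zero (A := A.submatrix f f) h
  have h2 := Matrix.rank_submatrix_le A f f
  simp at h1
  omega

lemma aux_pm {x : ℝ} (h : x = 1 ∨ x = -1) : x ≠ 0 := by
  rcases h with h | h <;> simp [h]

lemma aux_tri {V : Type*} [Fintype V] [DecidableEq V]
    (G : SimpleGraph V) (σ : V → V → ℝ) 
    (hsym : ∀ u v, σ u v = σ v u)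
    (hpm : ∀ u v, G.Adj u v → σ u v = 1 ∨ σ u v = -1) (f : Fin 3 → V) :
    ((sadj G σ).submatrix f f).det ≠ 0 ↔
      (G.Adj (f 0) (f 1) ∧ G.Adj (f 1) (f 2) ∧ G.Adj (f 0) (f 2)) := by
  have e : ((sadj G σ).submatrix f f).det = 
     2 * sadj G σ (f 0) (f 1) * sadj G σ (f 1) (f 2) * sadj G σ (f 0) (f 2) := by
    rw [Matrix.det_fin_three]
    simp [sadj, G.adj_comm (f 1) (f 0), G.adj_comm (f 2) (f 1), G.adj_comm (f 2) (f 0),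
      hsym (f 1) (f 0), hsym (f 2) (f 1), hsym (f 2) (f 0)]
    split_ifs <;> ring
  rw [e]
  constructor
  · intro h
    simp only [sadj] at h
    split_ifs at h <;> simp_all
  · rintro ⟨h1, h2, h3⟩
    simp [sadj, h1, h2, h3, aux_pm (hpm _ _ h1), aux_pm (hpm _ _ h2), aux_pm (hpm _ _ h3)]

lemma aux_four {V : Type*} [Fintype V] [DecidableEq V]
    (G : SimpleGraph V) (σ : V → V → ℝ)
    (hconn : G.Connected) (huni : G.edgeSet.ncard = Fintype.card V)
    (hpm : ∀ u v, G.Adj u v → σ u v = 1 ∨ σ u v = -1)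
    {a b c d : V} (hab : G.Adj a b) (hbc : G.Adj b c) (hac : G.Adj a c)
    (hda : G.Adj d a) (hdb : d ≠ b) (hdc : d ≠ c) : 4 ≤ (sadj G σ).rank := by
  have nb : ¬ G.Adj d b := fun h => aux_edges G hconn huni hab hbc hac hda h hdc
  have nc : ¬ G.Adj d c := fun h => aux_edges G hconn huni hac hbc.symm hab hda h hdb
  apply aux_rank _ 4 ![a, b, c, d]
  have n1 := aux_pm (hpm _ _ hda)
  have n2 := aux_pm (hpm _ _ hda.symm)
  have n3 := aux_pm (hpm _ _ hbc)
  have n4 := aux_pm (hpm _ _ hbc.symm)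
  have e : ((sadj G σ).submatrix ![a, b, c, d] ![a, b, c, d]).det =
      σ a d * σ d a * σ b c * σ c b := by
    have nb' : ¬ G.Adj b d := fun h => nb h.symm
    have nc' : ¬ G.Adj c d := fun h => nc h.symm
    have em : (sadj G σ).submatrix ![a, b, c, d] ![a, b, c, d] =
        !![0, σ a b, σ a c, σ a d; σ b a, 0, σ b c, 0; σ c a, σ c b, 0, 0; σ d a, 0, 0, 0] := by
      ext i j
      fin_cases i <;> fin_cases j <;>
        simp [sadj, hab, hbc, hac, hda, hab.symm, hbc.symm, hac.symm, hda.symm, nb, nc, nb', nc']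
    rw [em]
    simp [Matrix.det_succ_row_zero, Fin.sum_univ_succ, Fin.succAbove]
    try ring
  rw [e]
  positivity

lemma aux_ns {V : Type*} [Fintype V] (G : SimpleGraph V) (h3 : Fintype.card V = 3) :
    (∀ v, (G.neighborSet v).ncard = 2) ↔ ∀ u v, u ≠ v → G.Adj u v := by
  have hc : ∀ v : V, ({v}ᶜ : Set V).ncard = 2 := fun v => by
    rw [Set.ncard_compl, Nat.card_eq_fintype_card, h3]; simp
  constructor
  · intro h u v huv
    have : G.neighborSet u = {u}ᶜ := Set.eq_of_subset_of_ncard_le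
      (fun w hw => by simpa using (SimpleGraph.Adj.ne hw).symm) (by rw [h, hc])
    have h' : v ∈ G.neighborSet u := by rw [this]; simpa using huv.symm
    exact h'
  · intro h v
    have : G.neighborSet v = {v}ᶜ := by
      ext w; exact ⟨fun hw => by simpa using (SimpleGraph.Adj.ne hw).symm, fun hw => h _ _ (Ne.symm hw)⟩
    rw [this, hc]

theorem stmt18 {V : Type*} [Fintype V] [DecidableEq V]
    (G : SimpleGraph V) (σ : V → V → ℝ)
    (hconn : G.Connected) (huni : G.edgeSet.ncard = Fintype.card V)
    (hsym : ∀ u v, σ u v = σ v u)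
    (hpm : ∀ u v, G.Adj u v → σ u v = 1 ∨ σ u v = -1) :
    nullity (sadj G σ) = Fintype.card V - 3 ↔
      (Fintype.card V = 3 ∧ ∀ v, (G.neighborSet v).ncard = 2) := by
  have hrn : (sadj G σ).rank + nullity (sadj G σ) = Fintype.card V := by
    have := LinearMap.finrank_range_add_finrank_ker (Matrix.mulVecLin (sadj G σ))
    rw [Module.finrank_fintype_fun_eq_card] at this
    exact this
  have hn : 3 ≤ Fintype.card V := by
    have h1 := G.card_edgeFinset_le_card_choose_two
    have h0 : 0 < Fintype.card V := Fintype.card_pos_iff.mpr hconn.nonempty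
    rw [SimpleGraph.edgeFinset, ← Set.ncard_eq_toFinset_card' G.edgeSet, huni] at h1
    by_contra hlt
    generalize Fintype.card V = n at *
    have : n = 1 ∨ n = 2 := by omega
    rcases this with rfl | rfl <;> simp at h1
  have hA : (sadj G σ).transpose = sadj G σ := by
    ext u v
    simp [sadj, G.adj_comm v u, hsym v u]
  constructor
  · intro h
    have hr : (sadj G σ).rank = 3 := by omega
    obtain ⟨f, hf⟩ := aux_minor _ hA hr
    obtain ⟨h01, h12, h02⟩ := (aux_tri G σ hsym hpm f).1 hf
    have hall : ∀ v, v = f 0 ∨ v = f 1 ∨ v = f 2 := by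
      by_contra! hcon
      obtain ⟨v, hv⟩ := hcon
      obtain ⟨p⟩ := hconn.preconnected (f 0) v
      obtain ⟨⟨⟨x, y⟩, hxy⟩, -, hx, hy⟩ := p.exists_boundary_dart {f 0, f 1, f 2} (by simp)
        (by simpa using hv)
      simp only [Set.mem_insert_iff, Set.mem_singleton_iff, not_or] at hx hy
      have hyx : G.Adj y x := hxy.symm
      have : 4 ≤ (sadj G σ).rank := by
        rcases hx with rfl | rfl | rfl
        · exact aux_four G σ hconn huni hpm h01 h12 h02 hyx hy.2.1 hy.2.2
        · exact aux_four G σ hconn huni hpm h01.symm h02 h12 hyx hy.1 hy.2.2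
        · exact aux_four G σ hconn huni hpm h02.symm h01 h12.symm hyx hy.1 hy.2.1
      omega
    have hc : Fintype.card V = 3 := by
      have hs : Function.Surjective f := fun v => by
        rcases hall v with h | h | h <;> exact ⟨_, h.symm⟩
      have := Fintype.card_le_of_surjective f hs
      simp at this
      omega
    refine ⟨hc, (aux_ns G hc).2 ?_⟩
    intro u v huv
    rcases hall u with rfl | rfl | rfl <;> rcases hall v with rfl | rfl | rfl <;>
      first
      | exact absurd rfl huv
      | assumption
      | (apply SimpleGraph.Adj.symm; assumption)
  · rintro ⟨hc, h⟩
    rw [aux_ns G hc] at h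
    let f := (Fintype.equivFinOfCardEq hc).symm
    have := aux_rank (sadj G σ) 3 f ((aux_tri G σ hsym hpm f).2
      ⟨h _ _ (by simp), h _ _ (by simp), h _ _ (by simp)⟩)
    omega
end

section
/- Let Γ be a unicyclic signed graph of order n ≥ 4. Then η(Γ) = n − 4 if and only if Γ is one of: an unbalanced 4-cycle, an unbalanced 6-cycle, a signed graph whose underlying graph is U₁(r,s) (triangle with r ≥ s ≥ 0, r+s ≥ 1 pendant edges attached at two of its vertices), a signed graph whose underlying graph is U₂(r,s) (4-cycle with r, s pendant edges attached at two non-adjacent vertices, r ≥ s ≥ 0, r+s ≥ 1), or a balanced signed graph whose underlying graph is U₃(r) (4-cycle with one vertex identified with a pendant vertex of a star K_{1,r+1}, r ≥ 1). -/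
open scoped Classical

/-- Underlying graph U₁(r,s): a triangle a,b,c with pendant edges attached at the two
vertices a and b (r at a, s at b, r + s ≥ 1, i.e. at least 4 vertices). -/
def IsU1 {V : Type*} [Fintype V] (G : SimpleGraph V) : Prop :=
  ∃ a b c : V, a ≠ b ∧ a ≠ c ∧ b ≠ c ∧
    G.Adj a b ∧ G.Adj b c ∧ G.Adj a c ∧
    (∀ v, v ≠ a → v ≠ b → v ≠ c →
      G.neighborSet v = {a} ∨ G.neighborSet v = {b}) ∧
    4 ≤ Fintype.card V

/-- Underlying graph U₂(r,s): a chordless square a,b,c,d with pendant edges attached at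
the two non-adjacent vertices a and c (r + s ≥ 1, i.e. at least 5 vertices). -/
def IsU2 {V : Type*} [Fintype V] (G : SimpleGraph V) : Prop :=
  ∃ a b c d : V, a ≠ b ∧ a ≠ c ∧ a ≠ d ∧ b ≠ c ∧ b ≠ d ∧ c ≠ d ∧
    G.Adj a b ∧ G.Adj b c ∧ G.Adj c d ∧ G.Adj d a ∧ ¬ G.Adj a c ∧ ¬ G.Adj b d ∧
    (∀ v, v ∉ ({a, b, c, d} : Set V) →
      G.neighborSet v = {a} ∨ G.neighborSet v = {c}) ∧
    5 ≤ Fintype.card V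

/-- Underlying graph U₃(r): a chordless square a,b,c,d with one vertex a identified with
a pendant vertex of a star K_{1,r+1} with center z and r ≥ 1 further pendant leaves. -/
def IsU3 {V : Type*} [Fintype V] (G : SimpleGraph V) : Prop :=
  ∃ a b c d z : V,
    a ≠ b ∧ a ≠ c ∧ a ≠ d ∧ a ≠ z ∧ b ≠ c ∧ b ≠ d ∧ b ≠ z ∧ c ≠ d ∧ c ≠ z ∧ d ≠ z ∧
    G.Adj a b ∧ G.Adj b c ∧ G.Adj c d ∧ G.Adj d a ∧ ¬ G.Adj a c ∧ ¬ G.Adj b d ∧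
    G.Adj a z ∧ ¬ G.Adj b z ∧ ¬ G.Adj c z ∧ ¬ G.Adj d z ∧
    (∀ v, v ∉ ({a, b, c, d, z} : Set V) → G.neighborSet v = {z}) ∧
    6 ≤ Fintype.card V

section Aux

def schurM {V : Type*} (A : Matrix V V ℝ) (x y : V) : Matrix V V ℝ :=
  fun u w => A x y * A u w - (A u y * A x w + A u x * A y w)

theorem nullity_zero_iff {V : Type*} [Fintype V] [DecidableEq V] (A : Matrix V V ℝ) :
    nullity A = Fintype.card V ↔ ∀ u w, A u w = 0 := by
  unfold nullity
  constructor
  · intro h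
    have h1 : LinearMap.ker A.mulVecLin = ⊤ := by
      apply Submodule.eq_top_of_finrank_eq
      rw [h, Module.finrank_fintype_fun_eq_card]
    intro u w
    have h2 : (Pi.single w 1 : V → ℝ) ∈ LinearMap.ker A.mulVecLin := by rw [h1]; trivial
    have h3 := congrFun (LinearMap.mem_ker.1 h2) u
    simpa using h3
  · intro h
    have : A = 0 := by ext u w; exact h u w
    rw [this, Matrix.mulVecLin_zero, LinearMap.ker_zero, finrank_top,
      Module.finrank_fintype_fun_eq_card]

theorem nullity_schur {V : Type*} [Fintype V] [DecidableEq V] (A : Matrix V V ℝ)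
    (hs : ∀ u v, A u v = A v u) (x y : V) (hx : A x x = 0) (hy : A y y = 0) (h : A x y ≠ 0) :
    nullity (schurM A x y) = nullity A + 2 := by
  set C := schurM A x y with hC
  let F : (V → ℝ) →ₗ[ℝ] ℝ × ℝ :=
    ((LinearMap.proj x).comp A.mulVecLin).prod ((LinearMap.proj y).comp A.mulVecLin)
  have key : ∀ f u, C.mulVec f u
      = A x y * A.mulVec f u - (A u y * A.mulVec f x + A u x * A.mulVec f y) := by
    intro f u
    simp only [Matrix.mulVec, dotProduct, hC, schurM, Finset.mul_sum, ← Finset.sum_add_distrib,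
      ← Finset.sum_sub_distrib]
    refine Finset.sum_congr rfl fun w _ => by ring
  have hle : LinearMap.ker A.mulVecLin ≤ LinearMap.ker C.mulVecLin := by
    intro f hf
    rw [LinearMap.mem_ker, Matrix.mulVecLin_apply] at *
    ext u
    rw [key, hf]; simp
  let T := F.domRestrict (LinearMap.ker C.mulVecLin)
  have hker : LinearMap.ker T = (LinearMap.ker A.mulVecLin).comap (LinearMap.ker C.mulVecLin).subtype := by
    ext ⟨f, hf⟩
    rw [LinearMap.mem_ker, Matrix.mulVecLin_apply] at hf
    simp only [LinearMap.mem_ker, Submodule.mem_comap, Submodule.subtype_apply,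
      Matrix.mulVecLin_apply]
    show (A.mulVec f x, A.mulVec f y) = 0 ↔ _
    constructor
    · intro h0
      rw [Prod.mk_eq_zero] at h0
      ext u
      have := congrFun hf u
      rw [key, h0.1, h0.2] at this
      simpa [h] using this
    · intro h0
      rw [h0]; rfl
  have hsurj : Function.Surjective T := by
    rintro ⟨p, q⟩
    have hz : C.mulVec (Pi.single x (q / A x y) + Pi.single y (p / A x y)) = 0 := by
      ext u
      rw [Matrix.mulVec_add, Matrix.mulVec_single, Matrix.mulVec_single]
      simp [hC, schurM, hx, hy, hs y x]
      ring
    refine ⟨⟨Pi.single x (q / A x y) + Pi.single y (p / A x y), hz⟩, ?_⟩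
    show (A.mulVec (Pi.single x (q / A x y) + Pi.single y (p / A x y)) x,
      A.mulVec (Pi.single x (q / A x y) + Pi.single y (p / A x y)) y) = _
    rw [Matrix.mulVec_add, Matrix.mulVec_single, Matrix.mulVec_single]
    simp [hx, hy, hs y x, h]
    constructor <;> field_simp
  have h1 := LinearMap.finrank_range_add_finrank_ker T
  rw [LinearMap.range_eq_top.2 hsurj, finrank_top, hker,
    (Submodule.comapSubtypeEquivOfLe hle).finrank_eq] at h1
  simp at h1
  unfold nullity
  omega

theorem schur_symm {V : Type*} (A : Matrix V V ℝ)
    (hs : ∀ u v, A u v = A v u) (x y : V) (u v : V) : schurM A x y u v = schurM A x y v u := by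
  simp only [schurM, hs v u, hs v y, hs v x, hs u y, hs u x]; ring

theorem nullity_two {V : Type*} [Fintype V] [DecidableEq V] (A : Matrix V V ℝ)
    (hn : 4 ≤ Fintype.card V)
    (hs : ∀ u v, A u v = A v u) (x y : V) (hx : A x x = 0) (hy : A y y = 0) (h : A x y ≠ 0)
    (x' y' : V) (hx' : schurM A x y x' x' = 0) (hy' : schurM A x y y' y' = 0)
    (h' : schurM A x y x' y' ≠ 0) :
    nullity A = Fintype.card V - 4 ↔ ∀ u w, schurM (schurM A x y) x' y' u w = 0 := by
  have h1 := nullity_schur A hs x y hx hy h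
  have h2 := nullity_schur _ (schur_symm A hs x y) x' y' hx' hy' h'
  rw [← nullity_zero_iff]
  omega

theorem nullity_one {V : Type*} [Fintype V] [DecidableEq V] (A : Matrix V V ℝ)
    (hn : 4 ≤ Fintype.card V)
    (hs : ∀ u v, A u v = A v u) (x y : V) (hx : A x x = 0) (hy : A y y = 0) (h : A x y ≠ 0)
    (h0 : ∀ u w, schurM A x y u w = 0) : nullity A ≠ Fintype.card V - 4 := by
  have h1 := nullity_schur A hs x y hx hy h
  have h2 := (nullity_zero_iff _).2 h0
  omega

theorem closed_univ {V : Type*} {G : SimpleGraph V} (hc : G.Connected) (S : V → Prop) (x : V)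
    (hx : S x) (h : ∀ u v, S u → G.Adj u v → S v) (y : V) : S y := by
  obtain ⟨w⟩ := hc.preconnected x y
  induction w with
  | nil => exact hx
  | cons hadj p ih => exact ih (h _ _ hx hadj)

theorem bal_of_switch {V : Type*} (G : SimpleGraph V) (σ : V → V → ℝ) (θ : V → ℝ)
    (h1 : ∀ u, θ u * θ u = 1) (h : ∀ u v, G.Adj u v → σ u v = θ u * θ v) : BalancedSG G σ := by
  have key : ∀ u v (w : G.Walk u v), walkSign G σ w = θ u * θ v := by
    intro u v w
    induction w with
    | nil => simp [walkSign, h1]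
    | @cons a b c hadj p ih =>
      simp only [walkSign, SimpleGraph.Walk.darts_cons, List.map_cons, List.prod_cons] at ih ⊢
      rw [ih, h _ _ hadj]
      linear_combination (θ a * θ c) * h1 b
  intro u w _
  rw [key, h1]

theorem bal4 {V : Type*} (G : SimpleGraph V) (σ : V → V → ℝ) (hb : BalancedSG G σ) (a b c d : V)
    (hab : G.Adj a b) (hbc : G.Adj b c) (hcd : G.Adj c d) (hda : G.Adj d a)
    (hac : a ≠ c) (hbd : b ≠ d) : σ a b * σ b c * σ c d * σ d a = 1 := by
  have := hb a (.cons hab (.cons hbc (.cons hcd (.cons hda .nil)))) (by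
    rw [SimpleGraph.Walk.cons_isCycle_iff]
    simp [hab.ne, hbc.ne, hcd.ne, hda.ne, hab.ne', hbc.ne', hcd.ne', hda.ne', hac, hbd,
      hac.symm, hbd.symm])
  simp [walkSign] at this
  linarith

theorem bal6 {V : Type*} (G : SimpleGraph V) (σ : V → V → ℝ) (hb : BalancedSG G σ)
    (a b c d e f : V)
    (hab : G.Adj a b) (hbc : G.Adj b c) (hcd : G.Adj c d) (hde : G.Adj d e) (hef : G.Adj e f)
    (hfa : G.Adj f a) (hnd : [a, b, c, d, e, f].Nodup) :
    σ a b * σ b c * σ c d * σ d e * σ e f * σ f a = 1 := by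
  simp at hnd
  have := hb a (.cons hab (.cons hbc (.cons hcd (.cons hde (.cons hef (.cons hfa .nil)))))) (by
    rw [SimpleGraph.Walk.cons_isCycle_iff]
    simp
    grind)
  simp [walkSign] at this
  linarith

end Aux

section Pend

structure SGM {V : Type*} (G : SimpleGraph V) (A : Matrix V V ℝ) : Prop where
  symm : ∀ u v, A u v = A v u
  one : ∀ u v, G.Adj u v → A u v = 1 ∨ A u v = -1
  zero : ∀ u v, ¬ G.Adj u v → A u v = 0

theorem SGM.ne {V : Type*} {G : SimpleGraph V} {A : Matrix V V ℝ} (h : SGM G A) {u v : V}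
    (ha : G.Adj u v) : A u v ≠ 0 := by
  rcases h.one u v ha with h | h <;> rw [h] <;> norm_num

theorem SGM.sq {V : Type*} {G : SimpleGraph V} {A : Matrix V V ℝ} (h : SGM G A) {u v : V}
    (ha : G.Adj u v) : A u v * A u v = 1 := by
  rcases h.one u v ha with h | h <;> rw [h] <;> norm_num

theorem SGM.adj {V : Type*} {G : SimpleGraph V} {A : Matrix V V ℝ} (h : SGM G A) {u v : V}
    (ha : A u v ≠ 0) : G.Adj u v := by
  by_contra h1; exact ha (h.zero _ _ h1)

theorem SGM.diag {V : Type*} {G : SimpleGraph V} {A : Matrix V V ℝ} (h : SGM G A) (u : V) :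
    A u u = 0 := h.zero _ _ (G.irrefl)

theorem pend_schur {V : Type*} {G : SimpleGraph V} {A : Matrix V V ℝ} (h : SGM G A) (v a : V)
    (hv : ∀ w, G.Adj v w ↔ w = a) (u w : V) :
    schurM A v a u w = if u = a ∨ w = a then 0 else A v a * A u w := by
  have h1 : ∀ w, w ≠ a → A v w = 0 := fun w hw => h.zero _ _ (by rw [hv]; exact hw)
  unfold schurM
  rw [h.symm u v]
  by_cases hu : u = a
  · subst hu
    simp [h.diag]
  · rw [h1 u hu]
    by_cases hw : w = a
    · subst hw; simp [h.diag, hu]; ring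
    · simp [hu, hw, h1 w hw]

theorem pend_iff {V : Type*} [Fintype V] [DecidableEq V] {G : SimpleGraph V} {A : Matrix V V ℝ}
    (hn : 4 ≤ Fintype.card V) (h : SGM G A) (v a : V)
    (hv : ∀ w, G.Adj v w ↔ w = a) (x y : V) (hx : x ≠ a) (hy : y ≠ a) (hxy : G.Adj x y) :
    nullity A = Fintype.card V - 4 ↔
      ∀ u w, u ≠ a → w ≠ a → A x y * A u w = A u y * A x w + A u x * A y w := by
  have hva : A v a ≠ 0 := h.ne ((hv a).2 rfl)
  rw [nullity_two A hn h.symm v a (h.diag _) (h.diag _) hva x y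
    (by rw [pend_schur h v a hv]; simp [h.diag]) (by rw [pend_schur h v a hv]; simp [h.diag])
    (by rw [pend_schur h v a hv]; simp [hx, hy, hva, h.ne hxy])]
  have key : ∀ u w, schurM (schurM A v a) x y u w = if u = a ∨ w = a then 0 else
      A v a * A v a * (A x y * A u w - (A u y * A x w + A u x * A y w)) := by
    intro u w
    rw [schurM]
    simp only [pend_schur h v a hv, hx, hy, or_false, false_or, if_false]
    by_cases hu : u = a
    · simp [hu]
    · by_cases hw : w = a
      · simp [hw]
      · simp [hu, hw]; ring
  simp only [key]
  constructor
  · intro H u w hu hw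
    have := H u w
    simp [hu, hw, hva] at this
    linarith
  · intro H u w
    split_ifs with h1
    · rfl
    · push Not at h1
      rw [H u w h1.1 h1.2]; simp

theorem pend_none {V : Type*} [Fintype V] [DecidableEq V] {G : SimpleGraph V} {A : Matrix V V ℝ}
    (hn : 4 ≤ Fintype.card V) (h : SGM G A) (v a : V)
    (hv : ∀ w, G.Adj v w ↔ w = a) (hnull : nullity A = Fintype.card V - 4) :
    ∃ x y, x ≠ a ∧ y ≠ a ∧ G.Adj x y := by
  by_contra hcon
  push Not at hcon
  refine nullity_one A hn h.symm v a (h.diag _) (h.diag _) (h.ne ((hv a).2 rfl)) ?_ hnull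
  intro u w
  rw [pend_schur h v a hv]
  split_ifs with h1
  · rfl
  · push Not at h1
    rw [h.zero _ _ (hcon u w h1.1 h1.2)]; simp

theorem exists_nbr {V : Type*} [Fintype V] {G : SimpleGraph V} (hc : G.Connected)
    (hn : 4 ≤ Fintype.card V) (u : V) : ∃ w, G.Adj u w := by
  by_contra hcon
  push Not at hcon
  have := closed_univ hc (fun w => w = u) u rfl (by rintro a b rfl hb; exact absurd hb (hcon b))
  have : Fintype.card V ≤ 1 := Fintype.card_le_one_iff.2 (fun a b => by rw [this a, this b])
  omega

theorem star_case {V : Type*} [Fintype V] [DecidableEq V] {G : SimpleGraph V}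
    (hc : G.Connected) (hn : 4 ≤ Fintype.card V) (v a x t1 t2 : V)
    (hv : ∀ w, G.Adj v w ↔ w = a) (hxa : x ≠ a) (hx : ∃ y, y ≠ a ∧ G.Adj x y)
    (hno : ∀ u w, u ≠ a → u ≠ x → w ≠ a → w ≠ x → ¬ G.Adj u w)
    (h12 : t1 ≠ t2) (h1 : G.Adj a t1) (h2 : G.Adj a t2)
    (h1' : t1 = x ∨ G.Adj t1 x) (h2' : t2 = x ∨ G.Adj t2 x)
    (hall : ∀ t, G.Adj a t → (t = x ∨ G.Adj t x) → t = t1 ∨ t = t2) : IsU1 G ∨ IsU2 G := by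
  have hrest : ∀ w, w ≠ a → w ≠ x → w ≠ t1 → w ≠ t2 →
      G.neighborSet w = {a} ∨ G.neighborSet w = {x} := by
    intro w hwa hwx hw1 hw2
    have hsub : ∀ u, G.Adj w u → u = a ∨ u = x := by
      intro u hu
      by_contra hcon
      push Not at hcon
      exact hno w u hwa hwx hcon.1 hcon.2 hu
    have hnb : ¬ (G.Adj w a ∧ G.Adj w x) := by
      rintro ⟨hh1, hh2⟩
      rcases hall w hh1.symm (Or.inr hh2) with h | h
      · exact hw1 h
      · exact hw2 h
    obtain ⟨u, hu⟩ := exists_nbr hc hn w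
    rcases hsub u hu with rfl | rfl
    · left
      ext z
      simp only [SimpleGraph.mem_neighborSet, Set.mem_singleton_iff]
      constructor
      · intro hz
        rcases hsub z hz with rfl | rfl
        · rfl
        · exact absurd ⟨hu, hz⟩ hnb
      · rintro rfl; exact hu
    · right
      ext z
      simp only [SimpleGraph.mem_neighborSet, Set.mem_singleton_iff]
      constructor
      · intro hz
        rcases hsub z hz with rfl | rfl
        · exact absurd ⟨hz, hu⟩ hnb
        · rfl
      · rintro rfl; exact hu
  by_cases e1 : t1 = x
  · subst e1
    left
    refine ⟨a, t1, t2, hxa.symm, h2.ne, h12, h1, ?_, h2, ?_, hn⟩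
    · rcases h2' with h | h
      · exact absurd h.symm h12
      · exact h.symm
    · intro w w1 w2 w3; exact hrest w w1 w2 w2 w3
  by_cases e2 : t2 = x
  · subst e2
    left
    refine ⟨a, t2, t1, hxa.symm, h1.ne, h12.symm, h2, ?_, h1, ?_, hn⟩
    · rcases h1' with h | h
      · exact absurd h h12
      · exact h.symm
    · intro w w1 w2 w3; exact hrest w w1 w2 w3 w2
  right
  have h1'' := h1'.resolve_left e1
  have h2'' := h2'.resolve_left e2
  have hax : ¬ G.Adj a x := by
    intro h
    rcases hall x h (Or.inl rfl) with h | h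
    · exact e1 h.symm
    · exact e2 h.symm
  refine ⟨a, t1, x, t2, h1.ne, hxa.symm, h2.ne, e1, h12, Ne.symm e2, h1, h1'', h2''.symm, h2.symm,
    hax, hno _ _ h1.ne' e1 h2.ne' e2, ?_, ?_⟩
  · intro w hw
    simp at hw
    exact hrest w hw.1 hw.2.2.1 hw.2.1 hw.2.2.2
  · have hva : v ≠ a := fun h => G.irrefl ((hv v).2 h)
    have n1 : v ≠ t1 := fun h => hxa ((hv x).1 (h ▸ h1''))
    have n2 : v ≠ t2 := fun h => hxa ((hv x).1 (h ▸ h2''))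
    have n3 : v ≠ x := by
      rintro rfl
      exact h1.ne' ((hv t1).1 h1''.symm)
    have hcard : ({v, a, t1, x, t2} : Finset V).card = 5 := by
      rw [Finset.card_insert_of_notMem, Finset.card_insert_of_notMem,
        Finset.card_insert_of_notMem, Finset.card_insert_of_notMem, Finset.card_singleton]
      · simpa using Ne.symm e2
      · simp [e1, h12]
      · simp [h1.ne, hxa.symm, h2.ne]
      · simp [hva, n1, n2, n3]
    rw [← hcard]
    exact Finset.card_le_univ _

theorem sqr_bal {V : Type*} {G : SimpleGraph V} {A : Matrix V V ℝ} {σ : V → V → ℝ}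
    (h : SGM G A) (hA : ∀ u v, G.Adj u v → σ u v = A u v)
    (a b c d z : V)
    (hab : a ≠ b) (hac : a ≠ c) (had : a ≠ d) (haz : a ≠ z) (hbc : b ≠ c) (hbd : b ≠ d)
    (hbz : b ≠ z) (hcd : c ≠ d) (hcz : c ≠ z) (hdz : d ≠ z)
    (aab : G.Adj a b) (abc : G.Adj b c) (acd : G.Adj c d) (ada : G.Adj d a)
    (nac : ¬ G.Adj a c) (nbd : ¬ G.Adj b d) (aaz : G.Adj a z) (nbz : ¬ G.Adj b z)
    (ncz : ¬ G.Adj c z) (ndz : ¬ G.Adj d z)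
    (hrest : ∀ v, v ∉ ({a, b, c, d, z} : Set V) → G.neighborSet v = {z})
    (hp : A a b * A b c * A c d * A d a = 1) : BalancedSG G σ := by
  let θ : V → ℝ := fun u => if u = a then 1 else if u = b then A a b else
    if u = c then A a b * A b c else if u = d then A a b * A b c * A c d else
    if u = z then A a z else if G.Adj z u then A a z * A z u else 1
  have ta : θ a = 1 := by simp [θ]
  have tb : θ b = A a b := by simp [θ, hab.symm]
  have tc : θ c = A a b * A b c := by simp [θ, hac.symm, hbc.symm]
  have td : θ d = A a b * A b c * A c d := by simp [θ, had.symm, hbd.symm, hcd.symm]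
  have tz : θ z = A a z := by simp [θ, haz.symm, hbz.symm, hcz.symm, hdz.symm]
  have q1 := h.sq aab
  have q2 := h.sq abc
  have q3 := h.sq acd
  have q4 := h.sq ada
  have q5 := h.sq aaz
  refine bal_of_switch G σ θ ?_ ?_
  · intro u
    simp only [θ]
    split_ifs with h1 h2 h3 h4 h5 h6
    · norm_num
    · exact q1
    · linear_combination q1 * (A b c * A b c) + q2
    · linear_combination q1 * (A b c * A b c) * (A c d * A c d) + q2 * (A c d * A c d) + q3
    · exact q5
    · linear_combination q5 * (A z u * A z u) + h.sq h6
    · norm_num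
  · have leaf : ∀ u v, u ∉ ({a, b, c, d, z} : Set V) → G.Adj u v → A u v = θ u * θ v := by
      intro u v hu huv
      have h1 : v = z := by
        have : v ∈ G.neighborSet u := huv
        rw [hrest u hu] at this
        exact this
      subst h1
      simp at hu
      have tu : θ u = A a v * A v u := by simp [θ, hu, huv.symm]
      rw [tu, tz, h.symm u v]
      linear_combination - q5 * A v u
    have hab' : A a b = θ a * θ b := by rw [ta, tb]; ring
    have hbc' : A b c = θ b * θ c := by rw [tb, tc]; linear_combination - q1 * A b c
    have hcd' : A c d = θ c * θ d := by
      rw [tc, td]; linear_combination - q1 * A b c * A b c * A c d - q2 * A c d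
    have hda' : A d a = θ d * θ a := by
      rw [td, ta]; linear_combination A a b * A b c * A c d * q4 - A d a * hp
    have haz' : A a z = θ a * θ z := by rw [ta, tz]; ring
    intro u v huv
    rw [hA u v huv]
    by_cases hu : u ∉ ({a, b, c, d, z} : Set V)
    · exact leaf u v hu huv
    by_cases hv : v ∉ ({a, b, c, d, z} : Set V)
    · rw [h.symm, mul_comm]; exact leaf v u hv huv.symm
    simp only [Set.mem_insert_iff, Set.mem_singleton_iff, not_not] at hu hv
    have hs := h.symm u v
    have hi := G.irrefl (v := u)
    have huv' := huv.symm
    rcases hu with rfl | rfl | rfl | rfl | rfl <;> rcases hv with rfl | rfl | rfl | rfl | rfl <;>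
    first
    | assumption
    | (exact absurd huv (by assumption))
    | (exact absurd huv' (by assumption))
    | (rw [hs, mul_comm]; assumption)

end Pend

section Count

theorem sum_adj {V : Type*} [Fintype V] [DecidableEq V] (G : SimpleGraph V)
    (huni : G.edgeSet.ncard = Fintype.card V) :
    ∑ u, ∑ w, (if G.Adj u w then 1 else 0) = 2 * Fintype.card V := by
  have h1 := G.sum_degrees_eq_twice_card_edges
  have h2 : G.edgeFinset.card = Fintype.card V := by
    rw [← huni, ← SimpleGraph.coe_edgeFinset, Set.ncard_coe_finset]
  rw [h2] at h1
  rw [← h1]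
  refine Finset.sum_congr rfl fun u _ => ?_
  rw [← SimpleGraph.card_neighborFinset_eq_degree, SimpleGraph.neighborFinset_eq_filter,
    Finset.card_filter]

theorem count_edges {V : Type*} [Fintype V] [DecidableEq V] (G : SimpleGraph V)
    (huni : G.edgeSet.ncard = Fintype.card V) (a : V) (P Q : Finset V)
    (haP : a ∉ P) (haQ : a ∉ Q) (hd : Disjoint P Q)
    (hadj : ∀ u w, u ≠ a → w ≠ a → (G.Adj u w ↔ (u ∈ P ∧ w ∈ Q) ∨ (u ∈ Q ∧ w ∈ P))) :
    (Finset.univ.filter (fun w => G.Adj a w)).card + P.card * Q.card = Fintype.card V := by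
  have h1 := sum_adj G huni
  have h2 : ∀ u w, (if G.Adj u w then 1 else 0 : ℕ) =
      (if u = a then 1 else 0) * (if G.Adj a w then 1 else 0)
      + (if G.Adj a u then 1 else 0) * (if w = a then 1 else 0)
      + (if u ∈ P then 1 else 0) * (if w ∈ Q then 1 else 0)
      + (if u ∈ Q then 1 else 0) * (if w ∈ P then 1 else 0) := by
    intro u w
    by_cases hu : u = a
    · subst hu; simp [haP, haQ]
    · by_cases hw : w = a
      · subst hw; simp [haP, haQ, hu, G.adj_comm w u]
      · have := hadj u w hu hw
        have d1 : ∀ z, z ∈ P → z ∉ Q := fun z hz => Finset.disjoint_left.1 hd hz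
        by_cases u1 : u ∈ P
        · have := d1 u u1
          by_cases w1 : w ∈ Q <;> simp_all
        · by_cases u2 : u ∈ Q <;> by_cases w1 : w ∈ P <;> simp_all
  rw [Finset.sum_congr rfl fun u _ => Finset.sum_congr rfl fun w _ => h2 u w] at h1
  simp only [Finset.sum_add_distrib, ← Finset.mul_sum, ← Finset.sum_mul] at h1
  simp only [Finset.sum_ite_mem, Finset.univ_inter, Finset.sum_ite_eq', Finset.mem_univ, if_true,
    Finset.sum_const, smul_eq_mul, mul_one, one_mul, ← Finset.card_filter] at h1
  have h3 := mul_comm P.card Q.card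
  omega

set_option maxHeartbeats 1000000 in
theorem pend_fwd {V : Type*} [Fintype V] [DecidableEq V] {G : SimpleGraph V} {A : Matrix V V ℝ}
    {σ : V → V → ℝ} (hn : 4 ≤ Fintype.card V) (hc : G.Connected)
    (huni : G.edgeSet.ncard = Fintype.card V) (h : SGM G A)
    (hA : ∀ u v, G.Adj u v → σ u v = A u v) (v a : V)
    (hv : ∀ w, G.Adj v w ↔ w = a) (hnull : nullity A = Fintype.card V - 4) :
    IsU1 G ∨ IsU2 G ∨ (IsU3 G ∧ BalancedSG G σ) := by
  obtain ⟨x, y, hx, hy, hxy⟩ := pend_none hn h v a hv hnull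
  have F := (pend_iff hn h v a hv x y hx hy hxy).1 hnull
  have hva : v ≠ a := fun h => G.irrefl ((hv v).2 h)
  have ne := h.ne hxy
  let P : Finset V := Finset.univ.filter (fun u => u ≠ a ∧ G.Adj u y)
  let Q : Finset V := Finset.univ.filter (fun u => u ≠ a ∧ G.Adj u x)
  have mP : ∀ u, u ∈ P ↔ u ≠ a ∧ G.Adj u y := fun u => by simp [P]
  have mQ : ∀ u, u ∈ Q ↔ u ≠ a ∧ G.Adj u x := fun u => by simp [Q]
  have hxP : x ∈ P := (mP _).2 ⟨hx, hxy⟩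
  have hyQ : y ∈ Q := (mQ _).2 ⟨hy, hxy.symm⟩
  have dis : ∀ u, u ∈ P → u ∉ Q := by
    intro u h1 h2
    rw [mP] at h1; rw [mQ] at h2
    have := F u u h1.1 h1.1
    rw [h.diag, h.symm x u, h.symm y u] at this
    have h3 := mul_ne_zero (h.ne h1.2) (h.ne h2.2)
    apply h3; linarith
  have zP : ∀ u, u ≠ a → u ∉ P → A u y = 0 := by
    intro u hu h1
    apply h.zero; intro h2; exact h1 ((mP _).2 ⟨hu, h2⟩)
  have zQ : ∀ u, u ≠ a → u ∉ Q → A u x = 0 := by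
    intro u hu h1
    apply h.zero; intro h2; exact h1 ((mQ _).2 ⟨hu, h2⟩)
  have adjPQ : ∀ u w, u ∈ P → w ∈ Q → G.Adj u w := by
    intro u w h1 h2
    have h3 := F u w ((mP _).1 h1).1 ((mQ _).1 h2).1
    rw [zQ u ((mP _).1 h1).1 (dis u h1)] at h3
    apply h.adj
    intro h4
    rw [h4, h.symm x w] at h3
    have := mul_ne_zero (h.ne ((mP _).1 h1).2) (h.ne ((mQ _).1 h2).2)
    apply this; linarith
  have adj_iff : ∀ u w, u ≠ a → w ≠ a →
      (G.Adj u w ↔ (u ∈ P ∧ w ∈ Q) ∨ (u ∈ Q ∧ w ∈ P)) := by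
    intro u w hu hw
    constructor
    · intro huw
      by_contra hcon
      push Not at hcon
      have h3 := F u w hu hw
      have h4 := mul_ne_zero ne (h.ne huw)
      apply h4
      rw [h3, h.symm x w, h.symm y w]
      by_cases h5 : u ∈ P
      · rw [zQ w hw (hcon.1 h5), zQ u hu (dis u h5)]; ring
      · rw [zP u hu h5]
        by_cases h6 : u ∈ Q
        · rw [zP w hw (hcon.2 h6)]; ring
        · rw [zQ u hu h6]; ring
    · rintro (⟨h1, h2⟩ | ⟨h1, h2⟩)
      · exact adjPQ u w h1 h2
      · exact (adjPQ w u h2 h1).symm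
  have haP : a ∉ P := by simp [P]
  have haQ : a ∉ Q := by simp [Q]
  have hd : Disjoint P Q := Finset.disjoint_left.2 (fun u => dis u)
  have cnt := count_edges G huni a P Q haP haQ hd adj_iff
  have iso : ∀ u, u ≠ a → u ∉ P → u ∉ Q → ∀ w, G.Adj u w ↔ w = a := by
    intro u hu h1 h2
    have : ∀ w, G.Adj u w → w = a := by
      intro w hw
      by_contra hwa
      rcases (adj_iff u w hu hwa).1 hw with h | h
      · exact h1 h.1
      · exact h2 h.1
    intro w
    refine ⟨this w, ?_⟩
    rintro rfl
    obtain ⟨z, hz⟩ := exists_nbr hc hn u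
    rw [← this z hz]; exact hz
  let T : Finset V := (P ∪ Q).filter (fun u => G.Adj a u)
  have mT : ∀ u, u ∈ T ↔ (u ∈ P ∨ u ∈ Q) ∧ G.Adj a u := fun u => by simp [T]
  have cT : T.card + P.card * Q.card = 1 + P.card + Q.card := by
    have e1 : (Finset.univ.filter (fun w => G.Adj a w)).card
        + (Finset.univ.filter (fun w => ¬ G.Adj a w)).card = Fintype.card V := by
      rw [Finset.card_filter_add_card_filter_not]; rfl
    have e2 : T.card + ((P ∪ Q).filter (fun u => ¬ G.Adj a u)).card = P.card + Q.card := by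
      rw [Finset.card_filter_add_card_filter_not, Finset.card_union_of_disjoint hd]
    have e3 : Finset.univ.filter (fun w => ¬ G.Adj a w)
        = insert a ((P ∪ Q).filter (fun u => ¬ G.Adj a u)) := by
      ext u
      simp only [Finset.mem_filter, Finset.mem_univ, true_and, Finset.mem_insert, Finset.mem_union]
      constructor
      · intro hu
        by_cases hua : u = a
        · exact Or.inl hua
        · right
          refine ⟨?_, hu⟩
          by_contra hcon
          push Not at hcon
          exact hu ((iso u hua hcon.1 hcon.2 a).2 rfl).symm
      · rintro (rfl | h1)
        · exact G.irrefl
        · exact h1.2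
    rw [e3, Finset.card_insert_of_notMem (by simp [haP, haQ])] at e1
    omega
  have T1 : 1 ≤ T.card := by
    rw [Nat.one_le_iff_ne_zero, Ne, Finset.card_eq_zero]
    intro hT
    have := closed_univ hc (fun u => u ∈ P ∨ u ∈ Q) x (Or.inl hxP) (by
      intro u w hu huw
      have hua : u ≠ a := by rintro rfl; exact hu.elim haP haQ
      by_cases hwa : w = a
      · subst hwa
        have : u ∈ T := (mT u).2 ⟨hu, huw.symm⟩
        rw [hT] at this; simp at this
      · rcases (adj_iff u w hua hwa).1 huw with h | h
        · exact Or.inr h.2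
        · exact Or.inl h.2) a
    exact this.elim haP haQ
  have P1 : 1 ≤ P.card := Finset.card_pos.2 ⟨x, hxP⟩
  have Q1 : 1 ≤ Q.card := Finset.card_pos.2 ⟨y, hyQ⟩
  by_cases p1 : P.card = 1
  · have hT : T.card = 2 := by rw [p1] at cT; omega
    obtain ⟨t1, t2, h12, hT⟩ := Finset.card_eq_two.1 hT
    obtain ⟨x', hP⟩ := Finset.card_eq_one.1 p1
    have : x = x' := by rw [hP] at hxP; simpa using hxP
    subst this
    have t1m := (mT t1).1 (by rw [hT]; simp)
    have t2m := (mT t2).1 (by rw [hT]; simp)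
    rw [← or_assoc]
    left
    have sP : ∀ u, u ∈ P ↔ u = x := fun u => by rw [hP]; simp
    refine star_case hc hn v a x t1 t2 hv hx ⟨y, hy, hxy⟩ ?_ h12 t1m.2 t2m.2 ?_ ?_ ?_
    · intro u w hu hux hw hwx huw
      rcases (adj_iff u w hu hw).1 huw with h | h
      · exact hux ((sP _).1 h.1)
      · exact hwx ((sP _).1 h.2)
    · exact t1m.1.imp (sP _).1 (fun h => ((mQ _).1 h).2)
    · exact t2m.1.imp (sP _).1 (fun h => ((mQ _).1 h).2)
    · intro t hat ht
      have : t ∈ T := (mT t).2 ⟨ht.imp (sP _).2 (fun h => (mQ _).2 ⟨hat.ne', h⟩), hat⟩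
      rw [hT] at this
      simpa using this
  by_cases q1 : Q.card = 1
  · have hT : T.card = 2 := by rw [q1] at cT; omega
    obtain ⟨t1, t2, h12, hT⟩ := Finset.card_eq_two.1 hT
    obtain ⟨x', hP⟩ := Finset.card_eq_one.1 q1
    have : y = x' := by rw [hP] at hyQ; simpa using hyQ
    subst this
    have t1m := (mT t1).1 (by rw [hT]; simp)
    have t2m := (mT t2).1 (by rw [hT]; simp)
    rw [← or_assoc]
    left
    have sP : ∀ u, u ∈ Q ↔ u = y := fun u => by rw [hP]; simp
    refine star_case hc hn v a y t1 t2 hv hy ⟨x, hx, hxy.symm⟩ ?_ h12 t1m.2 t2m.2 ?_ ?_ ?_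
    · intro u w hu hux hw hwx huw
      rcases (adj_iff u w hu hw).1 huw with h | h
      · exact hwx ((sP _).1 h.2)
      · exact hux ((sP _).1 h.1)
    · exact t1m.1.symm.imp (sP _).1 (fun h => ((mP _).1 h).2)
    · exact t2m.1.symm.imp (sP _).1 (fun h => ((mP _).1 h).2)
    · intro t hat ht
      have : t ∈ T := (mT t).2 ⟨(ht.imp (sP _).2 (fun h => (mP _).2 ⟨hat.ne', h⟩)).symm, hat⟩
      rw [hT] at this
      simpa using this
  right; right
  have hp2 : 2 ≤ P.card := by omega
  have hq2 : 2 ≤ Q.card := by omega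
  have hpc : P.card = 2 := by nlinarith
  have hqc : Q.card = 2 := by rw [hpc] at cT; omega
  have htc : T.card = 1 := by rw [hpc, hqc] at cT; omega
  obtain ⟨t, hT⟩ := Finset.card_eq_one.1 htc
  have tm := (mT t).1 (by rw [hT]; simp)
  have tuniq : ∀ u, (u ∈ P ∨ u ∈ Q) → u ≠ t → ¬ G.Adj u a := by
    intro u hu hut hadj
    have := (mT u).2 ⟨hu, hadj.symm⟩
    rw [hT] at this
    exact hut (by simpa using this)
  -- general square finishing step
  have fin : ∀ b c d, t ≠ b → t ≠ c → t ≠ d → b ≠ c → b ≠ d → c ≠ d →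
      G.Adj t b → G.Adj b c → G.Adj c d → G.Adj d t → ¬ G.Adj t c → ¬ G.Adj b d →
      (∀ u, (u ∈ P ∨ u ∈ Q) ↔ u = t ∨ u = b ∨ u = c ∨ u = d) →
      A t b * A b c * A c d * A d t = 1 → IsU3 G ∧ BalancedSG G σ := by
    intro b c d tb tc td bc bd cd atb abc acd adt ntc nbd hm hp
    have nea : ∀ u, (u ∈ P ∨ u ∈ Q) → u ≠ a := by
      rintro u hu rfl; exact hu.elim haP haQ
    have hb := (hm b).2 (by simp)
    have hcc := (hm c).2 (by simp)
    have hdd := (hm d).2 (by simp)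
    have hrest : ∀ v, v ∉ ({t, b, c, d, a} : Set V) → G.neighborSet v = {a} := by
      intro u hu
      simp only [Set.mem_insert_iff, Set.mem_singleton_iff, not_or] at hu
      have : ¬ (u ∈ P ∨ u ∈ Q) := by
        rw [hm]; tauto
      push Not at this
      ext w
      simpa using iso u hu.2.2.2.2 this.1 this.2 w
    refine ⟨⟨t, b, c, d, a, tb, tc, td, nea t tm.1, bc, bd, nea b hb, cd, nea c hcc, nea d hdd,
      atb, abc, acd, adt, ntc, nbd, tm.2.symm, tuniq b hb tb.symm, tuniq c hcc tc.symm,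
      tuniq d hdd td.symm, hrest, ?_⟩,
      sqr_bal h hA t b c d a tb tc td (nea t tm.1) bc bd (nea b hb) cd (nea c hcc) (nea d hdd)
      atb abc acd adt ntc nbd tm.2.symm (tuniq b hb tb.symm) (tuniq c hcc tc.symm)
      (tuniq d hdd td.symm) hrest hp⟩
    have hcard : (insert v (insert a (P ∪ Q))).card = 6 := by
      rw [Finset.card_insert_of_notMem, Finset.card_insert_of_notMem,
        Finset.card_union_of_disjoint hd, hpc, hqc]
      · simp [haP, haQ]
      · simp only [Finset.mem_insert, hva, false_or, Finset.mem_union]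
        rintro (hh | hh)
        · exact hy ((hv _).1 (adjPQ _ _ hh hyQ))
        · exact hx ((hv _).1 (adjPQ _ _ hxP hh).symm)
    rw [← hcard]
    exact Finset.card_le_univ _
  obtain ⟨x', hx'P, hxx'⟩ : ∃ x' ∈ P, x' ≠ x := Finset.exists_mem_ne (by omega) x
  obtain ⟨y', hy'Q, hyy'⟩ : ∃ y' ∈ Q, y' ≠ y := Finset.exists_mem_ne (by omega) y
  have eP : P = {x, x'} := by
    symm; apply Finset.eq_of_subset_of_card_le
    · intro u hu; simp at hu; rcases hu with rfl | rfl <;> assumption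
    · rw [hpc, Finset.card_pair hxx'.symm]
  have eQ : Q = {y, y'} := by
    symm; apply Finset.eq_of_subset_of_card_le
    · intro u hu; simp at hu; rcases hu with rfl | rfl <;> assumption
    · rw [hqc, Finset.card_pair hyy'.symm]
  have nea : ∀ u, (u ∈ P ∨ u ∈ Q) → u ≠ a := by
    rintro u hu rfl; exact hu.elim haP haQ
  have a1 := adjPQ x y hxP hyQ
  have a2 := adjPQ x y' hxP hy'Q
  have a3 := adjPQ x' y hx'P hyQ
  have a4 := adjPQ x' y' hx'P hy'Q
  have n1 : ¬ G.Adj x x' := by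
    rw [adj_iff x x' hx (nea _ (Or.inl hx'P))]
    have := dis x hxP
    have := dis x' hx'P
    tauto
  have n2 : ¬ G.Adj y y' := by
    rw [adj_iff y y' hy (nea _ (Or.inr hy'Q))]
    have := fun h => dis y h hyQ
    have := fun h => dis y' h hy'Q
    tauto
  have hmem : ∀ u, (u ∈ P ∨ u ∈ Q) ↔ u = x ∨ u = x' ∨ u = y ∨ u = y' := by
    intro u; rw [eP, eQ]; simp [or_assoc]
  have hF := F x' y' (nea _ (Or.inl hx'P)) (nea _ (Or.inr hy'Q))
  rw [h.zero x' x (fun hh => n1 hh.symm)] at hF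
  have hprod : A x y * A x y' * A x' y * A x' y' = 1 := by
    have := h.sq a2
    have := h.sq a3
    linear_combination (A x y' * A x' y) * hF + (A x' y * A x' y) * h.sq a2 + h.sq a3
  have s1 := h.symm y x
  have s2 := h.symm y' x
  have s3 := h.symm y x'
  have s4 := h.symm y' x'
  rcases (hmem t).1 tm.1 with rfl | rfl | rfl | rfl
  · refine fin y x' y' a1.ne hxx'.symm a2.ne a3.ne' hyy'.symm a4.ne a1 a3.symm a4 a2.symm n1 n2
      ?_ ?_
    · intro u; rw [hmem]; clear * -; grind
    · rw [s3, s2]; linarith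
  · refine fin y x y' a3.ne hxx' a4.ne a1.ne' hyy'.symm a2.ne a3 a1.symm a2 a4.symm
      (fun h => n1 h.symm) n2 ?_ ?_
    · intro u; rw [hmem]; clear * -; grind
    · rw [s1, s4]; linarith
  · refine fin x y' x' a1.ne' hyy'.symm a3.ne' a2.ne hxx'.symm a4.ne' a1.symm a2 a4.symm a3 n2 n1
      ?_ ?_
    · intro u; rw [hmem]; clear * -; grind
    · rw [s1, s4]; linarith
  · refine fin x y x' a2.ne' hyy' a4.ne' a1.ne hxx'.symm a3.ne' a2.symm a1 a3.symm a4
      (fun h => n2 h.symm) n1 ?_ ?_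
    · intro u; rw [hmem]; clear * -; grind
    · rw [s2, s3]; linarith

end Count

section Cyc

theorem card_of_list {V : Type*} [Fintype V] [DecidableEq V] (l : List V) (hl : l.Nodup)
    (h : ∀ u, u ∈ l) : Fintype.card V = l.length := by
  rw [← List.toFinset_card_of_nodup hl, ← Finset.card_univ]
  congr 1
  ext u; simp [h]

theorem list_of_card {V : Type*} [Fintype V] [DecidableEq V] (l : List V) (hl : l.Nodup)
    (h : Fintype.card V = l.length) : ∀ u, u ∈ l := by
  intro u
  have : l.toFinset = Finset.univ := by
    rw [← Finset.card_eq_iff_eq_univ, List.toFinset_card_of_nodup hl, h]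
  rw [← List.mem_toFinset, this]; simp

theorem other {V : Type*} {G : SimpleGraph V} (hd : ∀ v, (G.neighborSet v).ncard = 2) (v u : V)
    (h : G.Adj v u) : ∃ w, w ≠ u ∧ ∀ t, G.Adj v t ↔ t = u ∨ t = w := by
  obtain ⟨x, y, hxy, hs⟩ := Set.ncard_eq_two.1 (hd v)
  have h1 : ∀ t, G.Adj v t ↔ t = x ∨ t = y := by
    intro t
    rw [← SimpleGraph.mem_neighborSet, hs]; simp
  rcases (h1 u).1 h with rfl | rfl
  · exact ⟨y, hxy.symm, h1⟩
  · exact ⟨x, hxy, fun t => by rw [h1, or_comm]⟩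

theorem cyc_struct {V : Type*} [Fintype V] [DecidableEq V] {G : SimpleGraph V}
    (hc : G.Connected) (hn : 4 ≤ Fintype.card V) (hd : ∀ v, (G.neighborSet v).ncard = 2) :
    (∃ a b c d : V, [a, b, c, d].Nodup ∧ (∀ u, u ∈ [a, b, c, d]) ∧
      (∀ t, G.Adj a t ↔ t = d ∨ t = b) ∧ (∀ t, G.Adj b t ↔ t = a ∨ t = c) ∧
      (∀ t, G.Adj c t ↔ t = b ∨ t = d) ∧ (∀ t, G.Adj d t ↔ t = c ∨ t = a)) ∨
    (∃ a b c d e : V, [a, b, c, d, e].Nodup ∧ (∀ u, u ∈ [a, b, c, d, e]) ∧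
      (∀ t, G.Adj a t ↔ t = e ∨ t = b) ∧ (∀ t, G.Adj b t ↔ t = a ∨ t = c) ∧
      (∀ t, G.Adj c t ↔ t = b ∨ t = d) ∧ (∀ t, G.Adj d t ↔ t = c ∨ t = e) ∧
      (∀ t, G.Adj e t ↔ t = d ∨ t = a)) ∨
    (∃ a b c d e f : V, [a, b, c, d, e, f].Nodup ∧ (∀ t, G.Adj b t ↔ t = a ∨ t = c) ∧
      (∀ t, G.Adj c t ↔ t = b ∨ t = d) ∧ (∀ t, G.Adj d t ↔ t = c ∨ t = e) ∧
      (∀ t, G.Adj e t ↔ t = d ∨ t = f)) := by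
  have hpos : 0 < Fintype.card V := by omega
  obtain ⟨b⟩ := Fintype.card_pos_iff.1 hpos
  obtain ⟨a, hba⟩ := exists_nbr hc hn b
  obtain ⟨c, hca, Nb⟩ := other hd b a hba
  have hbc : G.Adj b c := (Nb c).2 (Or.inr rfl)
  obtain ⟨d, hdb, Nc⟩ := other hd c b hbc.symm
  have hcd : G.Adj c d := (Nc d).2 (Or.inr rfl)
  have n1 := hba.ne
  have n2 := hbc.ne
  have n3 := hcd.ne
  have hda : d ≠ a := by
    rintro rfl
    obtain ⟨w, hw, Nd⟩ := other hd d b hba.symm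
    have hwc : w = c := by
      rcases (Nd c).1 hcd.symm with h | h
      · exact absurd h.symm n2
      · exact h.symm
    subst hwc
    have := closed_univ hc (fun u => u ∈ [d, b, w]) b (by simp) (by
      intro u v hu huv
      simp at hu ⊢
      rcases hu with rfl | rfl | rfl
      · rcases (Nd v).1 huv with h | h <;> simp [h]
      · rcases (Nb v).1 huv with h | h <;> simp [h]
      · rcases (Nc v).1 huv with h | h <;> simp [h])
    have := card_of_list [d, b, w] (by simp [n1.symm, n2, n3.symm]) this
    simp at this; omega
  obtain ⟨e, hec, Nd⟩ := other hd d c hcd.symm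
  have hde : G.Adj d e := (Nd e).2 (Or.inr rfl)
  have n4 := hde.ne
  by_cases hea : e = a
  · subst hea
    left
    obtain ⟨w, hw, Ne⟩ := other hd e d hde.symm
    have hwb : w = b := by
      rcases (Ne b).1 hba.symm with h | h
      · exact absurd h.symm hdb
      · exact h.symm
    subst hwb
    refine ⟨e, w, c, d, ?_, ?_, Ne, Nb, Nc, Nd⟩
    · simp [n1.symm, hca.symm, hda.symm, n2, hdb.symm, n3]
    · refine closed_univ hc (fun u => u ∈ [e, w, c, d]) w (by simp) ?_
      intro u v hu huv
      simp at hu ⊢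
      rcases hu with rfl | rfl | rfl | rfl
      · rcases (Ne v).1 huv with h | h <;> simp [h]
      · rcases (Nb v).1 huv with h | h <;> simp [h]
      · rcases (Nc v).1 huv with h | h <;> simp [h]
      · rcases (Nd v).1 huv with h | h <;> simp [h]
  right
  have heb : e ≠ b := by
    rintro rfl
    rcases (Nb d).1 hde.symm with h | h
    · exact hda h
    · exact n3 h.symm
  obtain ⟨f, hfd, Ne⟩ := other hd e d hde.symm
  have hef : G.Adj e f := (Ne f).2 (Or.inr rfl)
  have n5 := hef.ne
  by_cases hfa : f = a
  · subst hfa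
    left
    obtain ⟨w, hw, Nf⟩ := other hd f e hef.symm
    have hwb : w = b := by
      rcases (Nf b).1 hba.symm with h | h
      · exact absurd h.symm heb
      · exact h.symm
    subst hwb
    refine ⟨f, w, c, d, e, ?_, ?_, Nf, Nb, Nc, Nd, Ne⟩
    · simp [n1.symm, hca.symm, hda.symm, n2, hdb.symm, n3, n5.symm, heb.symm, hec.symm, n4]
    · refine closed_univ hc (fun u => u ∈ [f, w, c, d, e]) w (by simp) ?_
      intro u v hu huv
      simp at hu ⊢
      rcases hu with rfl | rfl | rfl | rfl | rfl
      · rcases (Nf v).1 huv with h | h <;> simp [h]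
      · rcases (Nb v).1 huv with h | h <;> simp [h]
      · rcases (Nc v).1 huv with h | h <;> simp [h]
      · rcases (Nd v).1 huv with h | h <;> simp [h]
      · rcases (Ne v).1 huv with h | h <;> simp [h]
  right
  have hfb : f ≠ b := by
    rintro rfl
    rcases (Nb e).1 hef.symm with h | h
    · exact hea h
    · exact hec h
  have hfc : f ≠ c := by
    rintro rfl
    rcases (Nc e).1 hef.symm with h | h
    · exact heb h
    · exact n4 h.symm
  refine ⟨a, b, c, d, e, f, ?_, Nb, Nc, Nd, Ne⟩
  simp [n1.symm, hca.symm, hda.symm, n2, hdb.symm, n3, n5, heb.symm, hec.symm, n4, hfd.symm,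
    hfc.symm, hfb.symm, _root_.Ne.symm hfa, _root_.Ne.symm hea]

theorem cyc4 {V : Type*} [Fintype V] [DecidableEq V] {G : SimpleGraph V} {A : Matrix V V ℝ}
    (h : SGM G A) (a b c d : V) (hl : [a, b, c, d].Nodup) (hall : ∀ u, u ∈ [a, b, c, d])
    (Na : ∀ t, G.Adj a t ↔ t = d ∨ t = b) (Nb : ∀ t, G.Adj b t ↔ t = a ∨ t = c)
    (Nc : ∀ t, G.Adj c t ↔ t = b ∨ t = d) (Nd : ∀ t, G.Adj d t ↔ t = c ∨ t = a) :
    nullity A = Fintype.card V - 4 ↔ A a b * A b c * A c d * A d a ≠ 1 := by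
  have hcard := card_of_list _ hl hall
  have hn : 4 ≤ Fintype.card V := by rw [hcard]; simp
  simp at hl hall
  have ab : G.Adj a b := by rw [Na]; simp
  have bc : G.Adj b c := by rw [Nb]; simp
  have cd : G.Adj c d := by rw [Nc]; simp
  have da : G.Adj d a := by rw [Nd]; simp
  have q1 := h.sq ab
  have q2 := h.sq bc
  have q3 := h.sq cd
  have q4 := h.sq da
  have z1 : A a c = 0 := h.zero _ _ (by rw [Na]; grind)
  have z2 : A b d = 0 := h.zero _ _ (by rw [Nb]; grind)
  have z3 : A c a = 0 := by rw [h.symm, z1]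
  have z4 : A d b = 0 := by rw [h.symm, z2]
  have s1 := h.symm b a
  have s2 := h.symm c b
  have s3 := h.symm d c
  have s4 := h.symm a d
  have d0 := h.diag
  constructor
  · intro hnull hp
    refine nullity_one A hn h.symm b c (h.diag _) (h.diag _) (h.ne bc) ?_ hnull
    have key : A b c * A d a = A a b * A c d := by
      linear_combination (A a b * A c d) * hp - (A b c * A d a) * (A c d * A c d) * q1
        - (A b c * A d a) * q3
    intro u w
    rcases hall u with rfl | rfl | rfl | rfl <;> rcases hall w with rfl | rfl | rfl | rfl <;>
    simp only [schurM, z1, z2, z3, z4, s1, s2, s3, s4, d0] <;>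
    first
    | ring1
    | linear_combination key
  · intro hp
    have hm : A a b * A b c * A c d * A d a = -1 := by
      rcases h.one _ _ ab with e1 | e1 <;> rcases h.one _ _ bc with e2 | e2 <;>
      rcases h.one _ _ cd with e3 | e3 <;> rcases h.one _ _ da with e4 | e4 <;>
      rw [e1, e2, e3, e4] at hp ⊢ <;> first | (norm_num; done) | exact absurd (by norm_num) hp
    have key : A b c * A d a = - (A a b * A c d) := by
      linear_combination (A a b * A c d) * hm - (A b c * A d a) * (A c d * A c d) * q1
        - (A b c * A d a) * q3
    rw [nullity_two A hn h.symm b c (h.diag _) (h.diag _) (h.ne bc) d a ?_ ?_ ?_]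
    · intro u w
      rcases hall u with rfl | rfl | rfl | rfl <;> rcases hall w with rfl | rfl | rfl | rfl <;>
      simp only [schurM, z1, z2, z3, z4, s1, s2, s3, s4, d0] <;> ring
    · simp only [schurM, z1, z2, z3, z4, s1, s2, s3, s4, d0]; ring
    · simp only [schurM, z1, z2, z3, z4, s1, s2, s3, s4, d0]; ring
    · simp only [schurM, z1, z2, z3, z4, s1, s2, s3, s4, d0]
      have := mul_ne_zero (h.ne bc) (h.ne da)
      intro h0
      apply this
      linarith

theorem cyc5 {V : Type*} [Fintype V] [DecidableEq V] {G : SimpleGraph V} {A : Matrix V V ℝ}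
    (hn : 4 ≤ Fintype.card V)
    (h : SGM G A) (a b c d e : V) (hl : [a, b, c, d, e].Nodup)
    (Na : ∀ t, G.Adj a t ↔ t = e ∨ t = b) (Nb : ∀ t, G.Adj b t ↔ t = a ∨ t = c)
    (Nc : ∀ t, G.Adj c t ↔ t = b ∨ t = d) (Nd : ∀ t, G.Adj d t ↔ t = c ∨ t = e)
    (Ne : ∀ t, G.Adj e t ↔ t = d ∨ t = a) :
    nullity A ≠ Fintype.card V - 4 := by
  simp at hl
  have ab : G.Adj a b := by rw [Na]; simp
  have bc : G.Adj b c := by rw [Nb]; simp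
  have cd : G.Adj c d := by rw [Nc]; simp
  have de : G.Adj d e := by rw [Nd]; simp
  have ea : G.Adj e a := by rw [Ne]; simp
  have z1 : A a c = 0 := h.zero _ _ (by rw [Na]; grind)
  have z2 : A b d = 0 := h.zero _ _ (by rw [Nb]; grind)
  have z3 : A b e = 0 := h.zero _ _ (by rw [Nb]; grind)
  have z4 : A c e = 0 := h.zero _ _ (by rw [Nc]; grind)
  have z5 : A a d = 0 := h.zero _ _ (by rw [Na]; grind)
  have y1 := (h.symm c a).trans z1
  have y2 := (h.symm d b).trans z2
  have y3 := (h.symm e b).trans z3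
  have y4 := (h.symm e c).trans z4
  have y5 := (h.symm d a).trans z5
  have s1 := h.symm b a
  have s2 := h.symm c b
  have s3 := h.symm d c
  have s4 := h.symm e d
  have s5 := h.symm a e
  have d0 := h.diag
  have nz := mul_ne_zero (mul_ne_zero (h.ne ab) (h.ne bc)) (mul_ne_zero (h.ne cd) (h.ne ea))
  intro hnull
  rw [nullity_two A hn h.symm b c (h.diag _) (h.diag _) (h.ne bc) d e ?_ ?_ ?_] at hnull
  · have := hnull a a
    simp only [schurM, z1, z2, z3, z4, z5, y1, y2, y3, y4, y5, s1, s2, s3, s4, s5, d0] at this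
    apply nz
    linarith
  · simp only [schurM, z1, z2, z3, z4, z5, y1, y2, y3, y4, y5, s1, s2, s3, s4, s5, d0]; ring
  · simp only [schurM, z1, z2, z3, z4, z5, y1, y2, y3, y4, y5, s1, s2, s3, s4, s5, d0]; ring
  · simp only [schurM, z1, z2, z3, z4, z5, y1, y2, y3, y4, y5, s1, s2, s3, s4, s5, d0]
    simpa using ⟨h.ne bc, h.ne de⟩

set_option maxHeartbeats 1000000 in
theorem cyc6 {V : Type*} [Fintype V] [DecidableEq V] {G : SimpleGraph V} {A : Matrix V V ℝ}
    (hn : 4 ≤ Fintype.card V)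
    (h : SGM G A) (a b c d e f : V) (hl : [a, b, c, d, e, f].Nodup)
    (Nb : ∀ t, G.Adj b t ↔ t = a ∨ t = c)
    (Nc : ∀ t, G.Adj c t ↔ t = b ∨ t = d) (Nd : ∀ t, G.Adj d t ↔ t = c ∨ t = e)
    (Ne : ∀ t, G.Adj e t ↔ t = d ∨ t = f) :
    (nullity A = Fintype.card V - 4 → A b c * A d e * A f a + A a b * A c d * A e f = 0) ∧
    (A b c * A d e * A f a + A a b * A c d * A e f = 0 → (∀ u, u ∈ [a, b, c, d, e, f]) →
      nullity A = Fintype.card V - 4) := by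
  simp at hl
  have ab : G.Adj a b := by rw [G.adj_comm, Nb]; simp
  have bc : G.Adj b c := by rw [Nb]; simp
  have cd : G.Adj c d := by rw [Nc]; simp
  have de : G.Adj d e := by rw [Nd]; simp
  have ef : G.Adj e f := by rw [Ne]; simp
  have x1 : A c a = 0 := h.zero _ _ (by rw [Nc]; grind)
  have x2 : A d a = 0 := h.zero _ _ (by rw [Nd]; grind)
  have x3 : A e a = 0 := h.zero _ _ (by rw [Ne]; grind)
  have x4 : A d b = 0 := h.zero _ _ (by rw [Nd]; grind)
  have x5 : A e b = 0 := h.zero _ _ (by rw [Ne]; grind)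
  have x6 : A b f = 0 := h.zero _ _ (by rw [Nb]; grind)
  have x7 : A e c = 0 := h.zero _ _ (by rw [Ne]; grind)
  have x8 : A c f = 0 := h.zero _ _ (by rw [Nc]; grind)
  have x9 : A d f = 0 := h.zero _ _ (by rw [Nd]; grind)
  have y1 := (h.symm a c).trans x1
  have y2 := (h.symm a d).trans x2
  have y3 := (h.symm a e).trans x3
  have y4 := (h.symm b d).trans x4
  have y5 := (h.symm b e).trans x5
  have y6 := (h.symm f b).trans x6
  have y7 := (h.symm c e).trans x7
  have y8 := (h.symm f c).trans x8
  have y9 := (h.symm f d).trans x9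
  have s1 := h.symm b a
  have s2 := h.symm c b
  have s3 := h.symm d c
  have s4 := h.symm e d
  have s5 := h.symm f e
  have s6 := h.symm a f
  have d0 := h.diag
  rw [nullity_two A hn h.symm b c (h.diag _) (h.diag _) (h.ne bc) d e ?_ ?_ ?_]
  · constructor
    · intro H
      have := H a f
      simp only [schurM, x1, x2, x3, x4, x5, x6, x7, x8, x9, y1, y2, y3, y4, y5, y6, y7, y8, y9,
        s1, s2, s3, s4, s5, s6, d0] at this
      have nz := h.ne bc
      have : A b c * (A b c * A d e * A f a + A a b * A c d * A e f) = 0 := by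
        linear_combination this
      exact (mul_eq_zero.1 this).resolve_left nz
    · intro key hall u w
      simp at hall
      rcases hall u with rfl | rfl | rfl | rfl | rfl | rfl <;>
      rcases hall w with rfl | rfl | rfl | rfl | rfl | rfl <;>
      simp only [schurM, x1, x2, x3, x4, x5, x6, x7, x8, x9, y1, y2, y3, y4, y5, y6, y7, y8, y9,
        s1, s2, s3, s4, s5, s6, d0] <;>
      first
      | ring1
      | linear_combination A b c * key
      | linear_combination A u c * key
      | linear_combination A w c * key
      | linear_combination A b u * key
      | linear_combination A b w * key
  · simp only [schurM, x4, y4, x5, d0]; ring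
  · simp only [schurM, x7, x5, y5, d0]; ring
  · simp only [schurM, x4, x7, y4, y5, y7]
    simpa using ⟨h.ne bc, h.ne de⟩

theorem switch4 {V : Type*} {G : SimpleGraph V} {A : Matrix V V ℝ} {σ : V → V → ℝ}
    (h : SGM G A) (hA : ∀ u v, G.Adj u v → σ u v = A u v)
    (a b c d : V) (hl : [a, b, c, d].Nodup) (hall : ∀ u, u ∈ [a, b, c, d])
    (Na : ∀ t, G.Adj a t ↔ t = d ∨ t = b) (Nb : ∀ t, G.Adj b t ↔ t = a ∨ t = c)
    (Nc : ∀ t, G.Adj c t ↔ t = b ∨ t = d) (Nd : ∀ t, G.Adj d t ↔ t = c ∨ t = a)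
    (hp : A a b * A b c * A c d * A d a = 1) : BalancedSG G σ := by
  simp at hl hall
  have q1 := h.sq ((Na b).2 (by simp))
  have q2 := h.sq ((Nb c).2 (by simp))
  have q3 := h.sq ((Nc d).2 (by simp))
  have q4 := h.sq ((Nd a).2 (by simp))
  let θ : V → ℝ := fun u => if u = a then 1 else if u = b then A a b else
    if u = c then A a b * A b c else A d a
  have ta : θ a = 1 := by simp [θ]
  have tb : θ b = A a b := by simp only [θ]; grind
  have tc : θ c = A a b * A b c := by simp only [θ]; grind
  have td : θ d = A d a := by simp only [θ]; grind
  refine bal_of_switch G σ θ ?_ ?_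
  · intro u
    rcases hall u with rfl | rfl | rfl | rfl
    · rw [ta]; norm_num
    · rw [tb]; exact q1
    · rw [tc]; linear_combination q1 * (A b u * A b u) + q2
    · rw [td]; exact q4
  · have hab' : A a b = θ a * θ b := by rw [ta, tb]; ring
    have hbc' : A b c = θ b * θ c := by rw [tb, tc]; linear_combination - q1 * A b c
    have hcd' : A c d = θ c * θ d := by
      rw [tc, td]; linear_combination A a b * A b c * A d a * q3 - A c d * hp
    have hda' : A d a = θ d * θ a := by rw [td, ta]; ring
    intro u v huv
    rw [hA u v huv]
    have hs := h.symm u v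
    rcases hall u with rfl | rfl | rfl | rfl
    · rcases (Na v).1 huv with rfl | rfl <;> first | assumption | (rw [hs, mul_comm]; assumption)
    · rcases (Nb v).1 huv with rfl | rfl <;> first | assumption | (rw [hs, mul_comm]; assumption)
    · rcases (Nc v).1 huv with rfl | rfl <;> first | assumption | (rw [hs, mul_comm]; assumption)
    · rcases (Nd v).1 huv with rfl | rfl <;> first | assumption | (rw [hs, mul_comm]; assumption)

theorem switch6 {V : Type*} {G : SimpleGraph V} {A : Matrix V V ℝ} {σ : V → V → ℝ}
    (h : SGM G A) (hA : ∀ u v, G.Adj u v → σ u v = A u v)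
    (a b c d e f : V) (hl : [a, b, c, d, e, f].Nodup) (hall : ∀ u, u ∈ [a, b, c, d, e, f])
    (Na : ∀ t, G.Adj a t ↔ t = f ∨ t = b) (Nb : ∀ t, G.Adj b t ↔ t = a ∨ t = c)
    (Nc : ∀ t, G.Adj c t ↔ t = b ∨ t = d) (Nd : ∀ t, G.Adj d t ↔ t = c ∨ t = e)
    (Ne : ∀ t, G.Adj e t ↔ t = d ∨ t = f) (Nf : ∀ t, G.Adj f t ↔ t = e ∨ t = a)
    (hp : A a b * A b c * A c d * A d e * A e f * A f a = 1) : BalancedSG G σ := by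
  simp at hl hall
  have q1 := h.sq ((Na b).2 (by simp))
  have q2 := h.sq ((Nb c).2 (by simp))
  have q3 := h.sq ((Nc d).2 (by simp))
  have q4 := h.sq ((Nd e).2 (by simp))
  have q5 := h.sq ((Ne f).2 (by simp))
  have q6 := h.sq ((Nf a).2 (by simp))
  let θ : V → ℝ := fun u => if u = a then 1 else if u = b then A a b else
    if u = c then A a b * A b c else if u = f then A f a else if u = e then A f a * A e f
    else A f a * A e f * A d e
  have ta : θ a = 1 := by simp [θ]
  have tb : θ b = A a b := by simp only [θ]; grind
  have tc : θ c = A a b * A b c := by simp only [θ]; grind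
  have tf : θ f = A f a := by simp only [θ]; grind
  have te : θ e = A f a * A e f := by simp only [θ]; grind
  have td : θ d = A f a * A e f * A d e := by simp only [θ]; grind
  refine bal_of_switch G σ θ ?_ ?_
  · intro u
    rcases hall u with rfl | rfl | rfl | rfl | rfl | rfl
    · rw [ta]; norm_num
    · rw [tb]; exact q1
    · rw [tc]; linear_combination q1 * (A b u * A b u) + q2
    · rw [td]; linear_combination q6 * (A e f * A e f) * (A u e * A u e) + q5 * (A u e * A u e) + q4
    · rw [te]; linear_combination q6 * (A u f * A u f) + q5
    · rw [tf]; exact q6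
  · have hab' : A a b = θ a * θ b := by rw [ta, tb]; ring
    have hbc' : A b c = θ b * θ c := by rw [tb, tc]; linear_combination - q1 * A b c
    have hcd' : A c d = θ c * θ d := by
      rw [tc, td]; linear_combination A a b * A b c * A d e * A e f * A f a * q3 - A c d * hp
    have hfa' : A f a = θ f * θ a := by rw [tf, ta]; ring
    have hef' : A e f = θ e * θ f := by rw [te, tf]; linear_combination - q6 * A e f
    have hde' : A d e = θ d * θ e := by
      rw [td, te]; linear_combination - q6 * A e f * A e f * A d e - q5 * A d e
    intro u v huv
    rw [hA u v huv]
    have hs := h.symm u v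
    rcases hall u with rfl | rfl | rfl | rfl | rfl | rfl
    · rcases (Na v).1 huv with rfl | rfl <;> first | assumption | (rw [hs, mul_comm]; assumption)
    · rcases (Nb v).1 huv with rfl | rfl <;> first | assumption | (rw [hs, mul_comm]; assumption)
    · rcases (Nc v).1 huv with rfl | rfl <;> first | assumption | (rw [hs, mul_comm]; assumption)
    · rcases (Nd v).1 huv with rfl | rfl <;> first | assumption | (rw [hs, mul_comm]; assumption)
    · rcases (Ne v).1 huv with rfl | rfl <;> first | assumption | (rw [hs, mul_comm]; assumption)
    · rcases (Nf v).1 huv with rfl | rfl <;> first | assumption | (rw [hs, mul_comm]; assumption)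

end Cyc

section Rev

theorem rev_star {V : Type*} [Fintype V] [DecidableEq V] {G : SimpleGraph V} {A : Matrix V V ℝ}
    (hn : 4 ≤ Fintype.card V) (h : SGM G A) (v a : V)
    (hv : ∀ w, G.Adj v w ↔ w = a) (p q : V) (hp : p ≠ a) (hq : q ≠ a) (hpq : G.Adj p q)
    (h1 : ∀ u, u ≠ a → u ≠ p → u ≠ q → ¬ G.Adj u p)
    (h2 : ∀ u w, u ≠ a → u ≠ p → u ≠ q → w ≠ a → w ≠ p → w ≠ q → ¬ G.Adj u w) :
    nullity A = Fintype.card V - 4 := by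
  rw [pend_iff hn h v a hv p q hp hq hpq]
  intro u w hu hw
  by_cases u1 : u = p
  · subst u1; rw [h.diag]; ring
  by_cases u2 : u = q
  · subst u2; rw [h.diag, h.symm u p]; ring
  by_cases w1 : w = p
  · subst w1; rw [h.diag, h.symm w q]; ring
  by_cases w2 : w = q
  · subst w2; rw [h.diag]; ring
  rw [h.zero _ _ (h2 u w hu u1 u2 hw w1 w2), h.zero _ _ (h1 u hu u1 u2), h.symm p w,
    h.zero _ _ (h1 w hw w1 w2)]
  ring

theorem nset {V : Type*} {G : SimpleGraph V} {v a : V} (h : G.neighborSet v = {a}) (w : V) :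
    G.Adj v w ↔ w = a := by
  rw [← SimpleGraph.mem_neighborSet, h]; simp

theorem rev_U1 {V : Type*} [Fintype V] [DecidableEq V] {G : SimpleGraph V} {A : Matrix V V ℝ}
    (h : SGM G A) (hU : IsU1 G) : nullity A = Fintype.card V - 4 := by
  have key : ∀ a b c v : V, a ≠ b → a ≠ c → b ≠ c → G.Adj a b → G.Adj b c → G.Adj a c →
      (∀ v, v ≠ a → v ≠ b → v ≠ c → (∀ w, G.Adj v w ↔ w = a) ∨ (∀ w, G.Adj v w ↔ w = b)) →
      4 ≤ Fintype.card V → (∀ w, G.Adj v w ↔ w = a) → nullity A = Fintype.card V - 4 := by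
    intro a b c v hab hac hbc ab bc ac hr hn hv
    refine rev_star hn h v a hv c b hac.symm hab.symm bc.symm ?_ ?_
    · intro u h1 h2 h3
      rcases hr u h1 h3 h2 with h | h <;> rw [h] <;> grind
    · intro u w h1 h2 h3 h4 h5 h6
      rcases hr u h1 h3 h2 with h | h <;> rw [h] <;> assumption
  obtain ⟨a, b, c, hab, hac, hbc, ab, bc, ac, hr, hn⟩ := hU
  obtain ⟨v, hv⟩ : ∃ v, v ∉ [a, b, c] := by
    by_contra hcon
    push Not at hcon
    have := card_of_list [a, b, c] (by simp [hab, hac, hbc]) hcon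
    simp at this; omega
  simp at hv
  have hr' : ∀ v, v ≠ a → v ≠ b → v ≠ c →
      (∀ w, G.Adj v w ↔ w = a) ∨ (∀ w, G.Adj v w ↔ w = b) :=
    fun v h1 h2 h3 => (hr v h1 h2 h3).imp nset nset
  rcases hr' v hv.1 hv.2.1 hv.2.2 with h1 | h1
  · exact key a b c v hab hac hbc ab bc ac hr' hn h1
  · exact key b a c v hab.symm hbc hac ab.symm ac bc
      (fun v h1 h2 h3 => (hr' v h2 h1 h3).symm) hn h1

theorem rev_U2 {V : Type*} [Fintype V] [DecidableEq V] {G : SimpleGraph V} {A : Matrix V V ℝ}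
    (h : SGM G A) (hU : IsU2 G) : nullity A = Fintype.card V - 4 := by
  have key : ∀ a b c d v : V, a ≠ b → a ≠ c → a ≠ d → b ≠ c → b ≠ d → c ≠ d →
      G.Adj b c → ¬ G.Adj b d →
      (∀ v, v ≠ a → v ≠ b → v ≠ c → v ≠ d →
        (∀ w, G.Adj v w ↔ w = a) ∨ (∀ w, G.Adj v w ↔ w = c)) →
      5 ≤ Fintype.card V → (∀ w, G.Adj v w ↔ w = a) → nullity A = Fintype.card V - 4 := by
    intro a b c d v hab hac had hbc hbd hcd bc nbd hr hn hv
    refine rev_star (by omega) h v a hv b c hab.symm hac.symm bc ?_ ?_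
    · intro u h1 h2 h3
      by_cases h4 : u = d
      · subst h4; exact fun h => nbd h.symm
      rcases hr u h1 h2 h3 h4 with h | h <;> rw [h] <;> grind
    · intro u w h1 h2 h3 h4 h5 h6
      by_cases h7 : u = d
      · subst h7
        by_cases h8 : w = u
        · subst h8; exact G.irrefl
        rw [G.adj_comm]
        rcases hr w h4 h5 h6 h8 with h | h <;> rw [h] <;> assumption
      rcases hr u h1 h2 h3 h7 with h | h <;> rw [h] <;> assumption
  obtain ⟨a, b, c, d, hab, hac, had, hbc, hbd, hcd, ab, bc, cd, da, nac, nbd, hr, hn⟩ := hU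
  obtain ⟨v, hv⟩ : ∃ v, v ∉ [a, b, c, d] := by
    by_contra hcon
    push Not at hcon
    have := card_of_list [a, b, c, d] (by simp [hab, hac, hbc, had, hbd, hcd]) hcon
    simp at this; omega
  simp at hv
  have hr' : ∀ v, v ≠ a → v ≠ b → v ≠ c → v ≠ d →
      (∀ w, G.Adj v w ↔ w = a) ∨ (∀ w, G.Adj v w ↔ w = c) :=
    fun v h1 h2 h3 h4 => (hr v (by simp [h1, h2, h3, h4])).imp nset nset
  rcases hr' v hv.1 hv.2.1 hv.2.2.1 hv.2.2.2 with h1 | h1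
  · exact key a b c d v hab hac had hbc hbd hcd bc nbd hr' hn h1
  · exact key c b a d v hbc.symm hac.symm hcd hab.symm hbd had ab.symm nbd
      (fun v h1 h2 h3 h4 => (hr' v h3 h2 h1 h4).symm) hn h1

theorem rev_U3 {V : Type*} [Fintype V] [DecidableEq V] {G : SimpleGraph V} {A : Matrix V V ℝ}
    {σ : V → V → ℝ} (h : SGM G A) (hA : ∀ u v, G.Adj u v → σ u v = A u v)
    (hU : IsU3 G) (hb : BalancedSG G σ) : nullity A = Fintype.card V - 4 := by
  obtain ⟨a, b, c, d, z, hab, hac, had, haz, hbc, hbd, hbz, hcd, hcz, hdz, ab, bc, cd, da, nac,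
    nbd, az, nbz, ncz, ndz, hr, hn⟩ := hU
  have hp := bal4 G σ hb a b c d ab bc cd da hac hbd
  rw [hA _ _ ab, hA _ _ bc, hA _ _ cd, hA _ _ da] at hp
  have q1 := h.sq bc
  have q2 := h.sq da
  have key : A a b * A c d = A b c * A d a := by
    linear_combination (A b c * A d a) * hp - (A a b * A c d) * (A d a * A d a) * q1
      - (A a b * A c d) * q2
  obtain ⟨v, hv⟩ : ∃ v, v ∉ [a, b, c, d, z] := by
    by_contra hcon
    push Not at hcon
    have := card_of_list [a, b, c, d, z]
      (by simp [hab, hac, hbc, had, hbd, hcd, haz, hbz, hcz, hdz]) hcon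
    simp at this; omega
  simp only [List.mem_cons, List.not_mem_nil, or_false] at hv
  have hleaf : ∀ u w, ¬ (u = a ∨ u = b ∨ u = c ∨ u = d) → u ≠ z → w ≠ z → A u w = 0 := by
    intro u w h1 h2 h3
    apply h.zero
    rw [nset (hr u (by simp only [Set.mem_insert_iff, Set.mem_singleton_iff]; tauto))]
    exact h3
  rw [pend_iff (by omega) h v z (nset (hr v (by simpa using hv))) a b haz hbz ab]
  intro u w hu hw
  by_cases u1 : u = a ∨ u = b ∨ u = c ∨ u = d
  · by_cases w1 : w = a ∨ w = b ∨ w = c ∨ w = d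
    · have s1 := h.symm b a
      have s2 := h.symm c b
      have s3 := h.symm d c
      have s4 := h.symm a d
      have z1 := h.zero _ _ nac
      have z2 := h.zero _ _ nbd
      have z3 := (h.symm c a).trans z1
      have z4 := (h.symm d b).trans z2
      have d0 := h.diag
      rcases u1 with rfl | rfl | rfl | rfl <;> rcases w1 with rfl | rfl | rfl | rfl <;>
      simp only [s1, s2, s3, s4, z1, z2, z3, z4, d0] <;>
      first
      | ring1
      | linear_combination key
    · rw [h.symm u w, h.symm a w, h.symm b w, hleaf w u w1 hw hu, hleaf w a w1 hw haz,
        hleaf w b w1 hw hbz]; ring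
  · rw [hleaf u w u1 hu hw, hleaf u b u1 hu hbz, hleaf u a u1 hu haz]; ring

theorem deg_cases {V : Type*} [Fintype V] [DecidableEq V] {G : SimpleGraph V}
    (hn : 4 ≤ Fintype.card V) (hc : G.Connected)
    (huni : G.edgeSet.ncard = Fintype.card V) :
    (∀ v, (G.neighborSet v).ncard = 2) ∨ ∃ v a, ∀ w, G.Adj v w ↔ w = a := by
  by_cases h1 : ∃ v, (G.neighborSet v).ncard = 1
  · right
    obtain ⟨v, hv⟩ := h1
    obtain ⟨a, ha⟩ := Set.ncard_eq_one.1 hv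
    exact ⟨v, a, nset ha⟩
  left
  push Not at h1
  have e : ∀ v, (G.neighborSet v).ncard = ∑ w, (if G.Adj v w then 1 else 0) := by
    intro v
    rw [← Finset.card_filter, ← Set.ncard_coe_finset]
    congr 1
    ext w; simp
  have h0 : ∀ v, (G.neighborSet v).ncard ≠ 0 := by
    intro v hv
    obtain ⟨w, hw⟩ := exists_nbr hc hn v
    rw [Set.ncard_eq_zero] at hv
    have : w ∈ G.neighborSet v := hw
    rw [hv] at this; exact this
  have hs := sum_adj G huni
  simp only [← e] at hs
  have h2 : ∀ v ∈ Finset.univ, 2 ≤ (G.neighborSet v).ncard := by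
    intro v _
    have := h0 v
    have := h1 v
    omega
  have := (Finset.sum_eq_sum_iff_of_le h2).1 (by rw [hs]; simp [mul_comm])
  intro v
  exact (this v (Finset.mem_univ v)).symm

theorem cyc_both {V : Type*} [Fintype V] [DecidableEq V] {G : SimpleGraph V} {A : Matrix V V ℝ}
    {σ : V → V → ℝ} (hn : 4 ≤ Fintype.card V) (hc : G.Connected)
    (h : SGM G A) (hA : ∀ u v, G.Adj u v → σ u v = A u v)
    (hd : ∀ v, (G.neighborSet v).ncard = 2) :
    nullity A = Fintype.card V - 4 ↔
      (Fintype.card V = 4 ∨ Fintype.card V = 6) ∧ ¬ BalancedSG G σ := by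
  rcases cyc_struct hc hn hd with ⟨a, b, c, d, hl, hall, Na, Nb, Nc, Nd⟩ |
    ⟨a, b, c, d, e, hl, hall, Na, Nb, Nc, Nd, Ne⟩ | ⟨a, b, c, d, e, f, hl, Nb, Nc, Nd, Ne⟩
  · have hcard : Fintype.card V = 4 := card_of_list _ hl hall
    rw [cyc4 h a b c d hl hall Na Nb Nc Nd]
    have ab : G.Adj a b := by rw [Na]; simp
    have bc : G.Adj b c := by rw [Nb]; simp
    have cd : G.Adj c d := by rw [Nc]; simp
    have da : G.Adj d a := by rw [Nd]; simp
    constructor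
    · intro hp
      refine ⟨Or.inl hcard, fun hb => hp ?_⟩
      simp at hl
      have := bal4 G σ hb a b c d ab bc cd da hl.1.2.1 hl.2.1.2
      rwa [hA _ _ ab, hA _ _ bc, hA _ _ cd, hA _ _ da] at this
    · rintro ⟨_, hb⟩ hp
      exact hb (switch4 h hA a b c d hl hall Na Nb Nc Nd hp)
  · have hcard : Fintype.card V = 5 := card_of_list _ hl hall
    constructor
    · intro hnull
      exact absurd hnull (cyc5 hn h a b c d e hl Na Nb Nc Nd Ne)
    · rintro ⟨h1 | h1, _⟩ <;> omega
  · obtain ⟨F1, F2⟩ := cyc6 hn h a b c d e f hl Nb Nc Nd Ne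
    have ab : G.Adj a b := by rw [G.adj_comm, Nb]; simp
    have bc : G.Adj b c := by rw [Nb]; simp
    have cd : G.Adj c d := by rw [Nc]; simp
    have de : G.Adj d e := by rw [Nd]; simp
    have ef : G.Adj e f := by rw [Ne]; simp
    have hl' := hl
    simp at hl'
    have card6 : 6 ≤ Fintype.card V := by
      have : [a, b, c, d, e, f].toFinset.card = 6 := List.toFinset_card_of_nodup hl
      rw [← this]; exact Finset.card_le_univ _
    obtain ⟨w, hwb, Na⟩ := other hd a b ab
    have hw2 : w ≠ c := by
      rintro rfl
      have := (Nc a).1 ((Na w).2 (by simp)).symm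
      grind
    have hw3 : w ≠ d := by
      rintro rfl
      have := (Nd a).1 ((Na w).2 (by simp)).symm
      grind
    have hw4 : w ≠ e := by
      rintro rfl
      have := (Ne a).1 ((Na w).2 (by simp)).symm
      grind
    have hwa : w ≠ a := by
      rintro rfl
      exact G.irrefl ((Na w).2 (by simp))
    have full : G.Adj f a → (∀ t, G.Adj a t ↔ t = f ∨ t = b) ∧ (∀ t, G.Adj f t ↔ t = e ∨ t = a) ∧
        (∀ u, u ∈ [a, b, c, d, e, f]) := by
      intro fa
      have hwf : w = f := by
        have := (Na f).1 fa.symm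
        grind
      subst hwf
      obtain ⟨w', hw', Nf⟩ := other hd w e ef.symm
      have hwa' : w' = a := by
        have := (Nf a).1 fa
        grind
      subst hwa'
      have Na' : ∀ t, G.Adj w' t ↔ t = w ∨ t = b := fun t => by rw [Na, or_comm]
      refine ⟨Na', Nf, ?_⟩
      refine closed_univ hc (fun u => u ∈ [w', b, c, d, e, w]) w' (by simp) ?_
      intro u v hu huv
      simp at hu ⊢
      rcases hu with rfl | rfl | rfl | rfl | rfl | rfl
      · rcases (Na v).1 huv with h | h <;> simp [h]
      · rcases (Nb v).1 huv with h | h <;> simp [h]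
      · rcases (Nc v).1 huv with h | h <;> simp [h]
      · rcases (Nd v).1 huv with h | h <;> simp [h]
      · rcases (Ne v).1 huv with h | h <;> simp [h]
      · rcases (Nf v).1 huv with h | h <;> simp [h]
    constructor
    · intro hnull
      have hk := F1 hnull
      have fa : G.Adj f a := by
        apply h.adj
        intro h0
        rw [h0] at hk
        have := mul_ne_zero (mul_ne_zero (h.ne ab) (h.ne cd)) (h.ne ef)
        apply this; linarith
      obtain ⟨Na', Nf, hall⟩ := full fa
      refine ⟨Or.inr (card_of_list _ hl hall), fun hb => ?_⟩
      have := bal6 G σ hb a b c d e f ab bc cd de ef fa hl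
      rw [hA _ _ ab, hA _ _ bc, hA _ _ cd, hA _ _ de, hA _ _ ef, hA _ _ fa] at this
      have h2 : (A a b * A c d * A e f) * (A a b * A c d * A e f) = -1 := by
        linear_combination (A a b * A c d * A e f) * hk - this
      nlinarith [mul_self_nonneg (A a b * A c d * A e f)]
    · rintro ⟨h1, hb⟩
      have hall := list_of_card _ hl (show Fintype.card V = 6 by omega)
      have fa : G.Adj f a := by
        have h3 := hall w
        simp at h3
        have : w = f := by tauto
        subst this
        exact ((Na w).2 (by simp)).symm
      obtain ⟨Na', Nf, _⟩ := full fa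
      refine F2 ?_ hall
      by_contra hne
      apply hb
      refine switch6 h hA a b c d e f hl hall Na' Nb Nc Nd Ne Nf ?_
      have r1 := h.sq ab
      have r2 := h.sq bc
      have r3 := h.sq cd
      have r4 := h.sq de
      have r5 := h.sq ef
      have r6 := h.sq fa
      have hX : (A b c * A d e * A f a) * (A b c * A d e * A f a) = 1 := by
        linear_combination r2 * (A d e * A d e) * (A f a * A f a) + r4 * (A f a * A f a) + r6
      have hY : (A a b * A c d * A e f) * (A a b * A c d * A e f) = 1 := by
        linear_combination r1 * (A c d * A c d) * (A e f * A e f) + r3 * (A e f * A e f) + r5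
      have : (A b c * A d e * A f a + A a b * A c d * A e f)
          * (A b c * A d e * A f a - A a b * A c d * A e f) = 0 := by
        linear_combination hX - hY
      have := (mul_eq_zero.1 this).resolve_left hne
      linear_combination (A a b * A c d * A e f) * this + hY

end Rev

/-- a unicyclic signed graph Γ of order n ≥ 4 has η(Γ) = n − 4 iff Γ is an
unbalanced 4-cycle, an unbalanced 6-cycle, a signed graph with underlying graph U₁(r,s)
or U₂(r,s), or a balanced signed graph with underlying graph U₃(r). -/
theorem stmt19 {V : Type*} [Fintype V] [DecidableEq V]
    (G : SimpleGraph V) (σ : V → V → ℝ)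
    (hn : 4 ≤ Fintype.card V)
    (hconn : G.Connected) (huni : G.edgeSet.ncard = Fintype.card V)
    (hsym : ∀ u v, σ u v = σ v u)
    (hpm : ∀ u v, G.Adj u v → σ u v = 1 ∨ σ u v = -1) :
    nullity (sadj G σ) = Fintype.card V - 4 ↔
      ((Fintype.card V = 4 ∧ (∀ v, (G.neighborSet v).ncard = 2) ∧ ¬ BalancedSG G σ) ∨
       (Fintype.card V = 6 ∧ (∀ v, (G.neighborSet v).ncard = 2) ∧ ¬ BalancedSG G σ) ∨
       IsU1 G ∨ IsU2 G ∨ (IsU3 G ∧ BalancedSG G σ)) := by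
  have h : SGM G (sadj G σ) := by
    refine ⟨?_, ?_, ?_⟩
    · intro u v
      unfold sadj
      rw [hsym u v]
      simp only [G.adj_comm u v]
    · intro u v huv
      simp only [sadj, huv, if_true]
      exact hpm u v huv
    · intro u v huv
      simp only [sadj, huv, if_false]
  have hA : ∀ u v, G.Adj u v → σ u v = sadj G σ u v := by
    intro u v huv
    simp only [sadj, huv, if_true]
  constructor
  · intro hnull
    rcases deg_cases hn hconn huni with hd | ⟨v, a, hv⟩
    · obtain ⟨h1 | h1, h2⟩ := (cyc_both hn hconn h hA hd).1 hnull
      · exact Or.inl ⟨h1, hd, h2⟩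
      · exact Or.inr (Or.inl ⟨h1, hd, h2⟩)
    · exact Or.inr (Or.inr (pend_fwd hn hconn huni h hA v a hv hnull))
  · rintro (⟨h1, hd, h2⟩ | ⟨h1, hd, h2⟩ | h1 | h1 | ⟨h1, h2⟩)
    · exact (cyc_both hn hconn h hA hd).2 ⟨Or.inl h1, h2⟩
    · exact (cyc_both hn hconn h hA hd).2 ⟨Or.inr h1, h2⟩
    · exact rev_U1 h h1
    · exact rev_U2 h h1
    · exact rev_U3 h hA h1 h2
end
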